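/- For every n ≥ 3 there exists a proper C^∞-smooth function H : ℝ^{2n} → ℝ with the following properties: the origin is the only critical point of H; H attains its absolute minimum at the origin with H(0) = 0; and there exists a sequence (ε_k) of positive regular values of H with ε_k → 0 such that each level set H⁻¹(ε_k) is diffeomorphic to the sphere S^{2n−1} and contains no nonconstant periodic orbit of the Hamiltonian flow of H, i.e., no nonconstant periodic solution of γ'(t) = J∇H(γ(t)) has its image contained in H⁻¹(ε_k). -/

import Mathlib

open scoped RealInnerProductSpace ENNReal NNReal Topology
open Metric Set

noncomputable section

/-- `ℝ^{2n}` identified with `ℂ^n`, with the standard (real) inner product and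
the standard complex structure `J` given by multiplication by `i`. -/
abbrev Esp (n : ℕ) := EuclideanSpace ℂ (Fin n)

variable {n : ℕ}

/-- The Hamiltonian vector field `X_H = J ∇H` of `H : ℝ^{2n} → ℝ`. -/
def hamVF (H : Esp n → ℝ) (x : Esp n) : Esp n := Complex.I • gradient H x

/-- A nonconstant `T`-periodic orbit of the Hamiltonian flow of `H`:
a nonconstant solution `γ` of `γ' = J∇H(γ)` with `γ (t + T) = γ t`. -/
def IsPeriodicOrbit (H : Esp n → ℝ) (γ : ℝ → Esp n) (T : ℝ) : Prop :=
  0 < T ∧ (∀ t, HasDerivAt γ (hamVF H (γ t)) t) ∧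
    (∀ t, γ (t + T) = γ t) ∧ ∃ t₀ t₁, γ t₀ ≠ γ t₁

/-- `H` has a fast (period `≤ 1`) nonconstant periodic orbit. -/
def HasFastOrbit (H : Esp n → ℝ) : Prop :=
  ∃ γ T, IsPeriodicOrbit H γ T ∧ T ≤ 1

/-- The symplectic action of a `1`-periodic loop `γ` with respect to the
(possibly time-dependent) Hamiltonian `H`:
`A_H(γ) = -(1/2)∫₀¹ ⟨Jγ(t), γ'(t)⟩ dt + ∫₀¹ H(t, γ(t)) dt`. -/
def action (H : ℝ → Esp n → ℝ) (γ : ℝ → Esp n) : ℝ :=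
  -(1 / 2) * (∫ t in (0:ℝ)..1, ⟪(Complex.I • γ t : Esp n), deriv γ t⟫) +
    ∫ t in (0:ℝ)..1, H t (γ t)

/-- The class `𝓗(V, Z)`: smooth functions on `ℝ^{2n}` with compact support
contained in `V`, constant on a neighborhood of `Z`, whose value on `Z` is the
maximum of `H`. -/
def InHclass (V Z : Set (Esp n)) (H : Esp n → ℝ) : Prop :=
  ContDiff ℝ (⊤ : ℕ∞) H ∧ IsCompact (tsupport H) ∧ tsupport H ⊆ V ∧
    (∃ U, IsOpen U ∧ Z ⊆ U ∧ ∃ c : ℝ, ∀ x ∈ U, H x = c) ∧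
    ∀ z ∈ Z, ∀ x, H x ≤ H z

/-- The relative Hofer–Zehnder capacity `c_HZ(V, Z)`: the supremum of `max H`
over all `H ∈ 𝓗(V, Z)` having no fast nonconstant periodic orbit (for `z ∈ Z`,
`H z = max H`). -/
def relCap (V Z : Set (Esp n)) : ℝ≥0∞ :=
  sSup {c | ∃ H, InHclass V Z H ∧ ¬ HasFastOrbit H ∧
    ∃ z ∈ Z, c = ENNReal.ofReal (H z)}

namespace Plug
set_option linter.unusedSectionVars false

/-! ### One-dimensional analysis of the plug profile -/

/-- Smooth cutoff with `rho 0 = 1`, strictly smaller than one on `(0, ∞)`, vanishing on `[1, ∞)`. -/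
def rho (x : ℝ) : ℝ := Real.exp 1 * expNegInvGlue (1 - x)

lemma rho_contDiff : ContDiff ℝ (⊤ : ℕ∞) rho := by
  unfold rho
  exact contDiff_const.mul (expNegInvGlue.contDiff.comp (contDiff_const.sub contDiff_id))

lemma rho_zero : rho 0 = 1 := by
  simp [rho, expNegInvGlue, ← Real.exp_add]

lemma rho_nonneg (x : ℝ) : 0 ≤ rho x :=
  mul_nonneg (Real.exp_pos _).le (expNegInvGlue.nonneg _)

lemma rho_antitone : Antitone rho := fun _ _ h =>
  mul_le_mul_of_nonneg_left (expNegInvGlue.monotone (by linarith)) (Real.exp_pos _).le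

lemma rho_eq_zero {x : ℝ} (h : 1 ≤ x) : rho x = 0 := by
  simp [rho, expNegInvGlue.zero_of_nonpos (show 1 - x ≤ 0 by linarith)]

lemma rho_le_one {x : ℝ} (h : 0 ≤ x) : rho x ≤ 1 := rho_zero ▸ rho_antitone h

lemma rho_lt_one {x : ℝ} (h : 0 < x) : rho x < 1 := by
  by_cases h1 : 1 ≤ x
  · rw [rho_eq_zero h1]; norm_num
  · push Not at h1
    have h2 : ¬ (1 - x ≤ 0) := by linarith
    simp only [rho, expNegInvGlue, h2, if_false, ← Real.exp_add]
    rw [Real.exp_lt_one_iff]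
    have : 1 < (1 - x)⁻¹ := (one_lt_inv₀ (by linarith)).2 (by linarith)
    linarith

lemma rho_deriv_nonpos (x : ℝ) : deriv rho x ≤ 0 := rho_antitone.deriv_nonpos

lemma rho_deriv_zero {x : ℝ} (h : 1 ≤ x) : deriv rho x = 0 := by
  apply IsLocalMin.deriv_eq_zero
  filter_upwards with y
  rw [rho_eq_zero h]; exact rho_nonneg y

lemma rho_hasDerivAt (x : ℝ) : HasDerivAt rho (deriv rho x) x :=
  (rho_contDiff.differentiable (by simp) x).hasDerivAt

def q (v : ℝ) : ℝ := (3 * v - v ^ 3) / 2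
def al (v r : ℝ) : ℝ := Real.pi / 2 * (q v * rho ((v ^ 2 - 1) ^ 2 + r))
def alr (v r : ℝ) : ℝ := Real.pi / 2 * (q v * deriv rho ((v ^ 2 - 1) ^ 2 + r))

lemma al_neg (v r : ℝ) : al (-v) r = - al v r := by simp only [al, q, neg_sq]; ring
lemma alr_neg (v r : ℝ) : alr (-v) r = - alr v r := by simp only [alr, q, neg_sq]; ring

lemma al_zero_of_le {v r : ℝ} (h : 1 ≤ (v ^ 2 - 1) ^ 2 + r) : al v r = 0 := by
  simp [al, rho_eq_zero h]
lemma alr_zero_of_le {v r : ℝ} (h : 1 ≤ (v ^ 2 - 1) ^ 2 + r) : alr v r = 0 := by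
  simp [alr, rho_deriv_zero h]

lemma q_abs_le {v : ℝ} (h : v ^ 2 ≤ 2) : |q v| ≤ 1 := by
  have h1 : -2 ≤ v := by nlinarith
  have h2 : v ≤ 2 := by nlinarith
  rw [abs_le, q]
  constructor
  · nlinarith [mul_nonneg (sq_nonneg (v + 1)) (sub_nonneg.2 h2)]
  · nlinarith [mul_nonneg (sq_nonneg (v - 1)) (show 0 ≤ v + 2 by linarith)]

lemma qrho_abs_le {v r : ℝ} (hr : 0 ≤ r) : |q v * rho ((v ^ 2 - 1) ^ 2 + r)| ≤ 1 := by
  by_cases h : v ^ 2 ≤ 2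
  · rw [abs_mul, abs_of_nonneg (rho_nonneg _)]
    exact mul_le_one₀ (q_abs_le h) (rho_nonneg _) (rho_le_one (by positivity))
  · push Not at h
    rw [rho_eq_zero (by nlinarith)]; simp

lemma al_abs_le {v r : ℝ} (hr : 0 ≤ r) : |al v r| ≤ Real.pi / 2 := by
  rw [al, abs_mul, abs_of_pos (by positivity)]
  exact mul_le_of_le_one_right (by positivity) (qrho_abs_le hr)

lemma cos_al_nonneg {v r : ℝ} (hr : 0 ≤ r) : 0 ≤ Real.cos (al v r) := by
  have := abs_le.1 (al_abs_le (v := v) hr)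
  exact Real.cos_nonneg_of_mem_Icc ⟨by linarith, by linarith⟩

lemma core_of_cos {v r : ℝ} (hr : 0 ≤ r) (h : Real.cos (al v r) = 0) : v ^ 2 = 1 ∧ r = 0 := by
  have h1 : |al v r| = Real.pi / 2 := by
    by_contra hne
    have hlt := lt_of_le_of_ne (al_abs_le (v := v) hr) hne
    have := Real.cos_pos_of_mem_Ioo (abs_lt.1 hlt)
    linarith
  rw [al, abs_mul, abs_of_pos (show (0:ℝ) < Real.pi / 2 by positivity)] at h1
  have h2 : |q v * rho ((v ^ 2 - 1) ^ 2 + r)| = 1 := by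
    have := Real.pi_pos
    field_simp at h1 ⊢
    linarith
  by_cases hv : v ^ 2 ≤ 2
  · have hR : (v ^ 2 - 1) ^ 2 + r = 0 := by
      by_contra hne
      have hpos : 0 < (v ^ 2 - 1) ^ 2 + r := lt_of_le_of_ne (by positivity) (Ne.symm hne)
      rw [abs_mul, abs_of_nonneg (rho_nonneg _)] at h2
      have := rho_lt_one hpos
      have := q_abs_le hv
      nlinarith [rho_nonneg ((v ^ 2 - 1) ^ 2 + r), abs_nonneg (q v)]
    have h3 : (v ^ 2 - 1) ^ 2 = 0 := by nlinarith [sq_nonneg (v ^ 2 - 1)]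
    refine ⟨by have := pow_eq_zero_iff (two_ne_zero) |>.1 h3; linarith, by linarith⟩
  · push Not at hv
    rw [rho_eq_zero (by nlinarith)] at h2; simp at h2

lemma q_mul_sin_nonneg {v r : ℝ} (hr : 0 ≤ r) : 0 ≤ q v * Real.sin (al v r) := by
  have hb := abs_le.1 (al_abs_le (v := v) hr)
  have hpi := Real.pi_pos
  rcases le_total 0 (q v) with h | h
  · apply mul_nonneg h
    apply Real.sin_nonneg_of_nonneg_of_le_pi
    · unfold al; exact mul_nonneg (by positivity) (mul_nonneg h (rho_nonneg _))
    · linarith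
  · apply mul_nonneg_of_nonpos_of_nonpos h
    apply Real.sin_nonpos_of_nonpos_of_neg_pi_le
    · unfold al; exact mul_nonpos_of_nonneg_of_nonpos (by positivity)
        (mul_nonpos_of_nonpos_of_nonneg h (rho_nonneg _))
    · linarith

/-- monotonicity of `sin²` of the angle -/
lemma sin_sq_mono {v r₁ r₂ : ℝ} (h1 : 0 ≤ r₁) (h : r₁ ≤ r₂) :
    Real.sin (al v r₂) ^ 2 ≤ Real.sin (al v r₁) ^ 2 := by
  have hpi := Real.pi_pos
  have e : ∀ r, |al v r| = Real.pi / 2 * (|q v| * rho ((v ^ 2 - 1) ^ 2 + r)) := fun r => by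
    rw [al, abs_mul, abs_mul, abs_of_nonneg (rho_nonneg _), abs_of_pos (by positivity)]
  have hle : |al v r₂| ≤ |al v r₁| := by
    rw [e, e]
    have := rho_antitone (show (v ^ 2 - 1) ^ 2 + r₁ ≤ (v ^ 2 - 1) ^ 2 + r₂ by linarith)
    gcongr
  have s : ∀ a : ℝ, Real.sin a ^ 2 = Real.sin |a| ^ 2 := fun a => by
    rcases abs_cases a with ⟨h, _⟩ | ⟨h, _⟩ <;> rw [h]
    simp
  rw [s, s (al v r₁)]
  have hb := al_abs_le (v := v) h1
  have hm := Real.sin_le_sin_of_le_of_le_pi_div_two (by linarith [abs_nonneg (al v r₂)]) hb hle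
  have h0 := Real.sin_nonneg_of_nonneg_of_le_pi (abs_nonneg (al v r₂)) (by linarith)
  gcongr

def KK (M D y v h : ℝ) : ℝ :=
  h * Real.cos (al v (M * (D + y ^ 2 + h ^ 2))) + y * Real.sin (al v (M * (D + y ^ 2 + h ^ 2)))
def NN (M D y v h : ℝ) : ℝ :=
  -h * Real.sin (al v (M * (D + y ^ 2 + h ^ 2))) + y * Real.cos (al v (M * (D + y ^ 2 + h ^ 2)))
def Kh (M D y v h : ℝ) : ℝ := Real.cos (al v (M * (D + y ^ 2 + h ^ 2))) +
  NN M D y v h * (alr v (M * (D + y ^ 2 + h ^ 2)) * (2 * M * h))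
def Ky (M D y v h : ℝ) : ℝ := Real.sin (al v (M * (D + y ^ 2 + h ^ 2))) +
  NN M D y v h * (alr v (M * (D + y ^ 2 + h ^ 2)) * (2 * M * y))
def KD (M D y v h : ℝ) : ℝ := NN M D y v h * (alr v (M * (D + y ^ 2 + h ^ 2)) * M)

lemma KK_hasDerivAt {M v x D' y' h' : ℝ} {D y h : ℝ → ℝ} (hD : HasDerivAt D D' x)
    (hy : HasDerivAt y y' x) (hh : HasDerivAt h h' x) :
    HasDerivAt (fun x => KK M (D x) (y x) v (h x))
      (Kh M (D x) (y x) v (h x) * h' + Ky M (D x) (y x) v (h x) * y' +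
        KD M (D x) (y x) v (h x) * D') x := by
  have hr : HasDerivAt (fun x => M * (D x + y x ^ 2 + h x ^ 2))
      (M * (D' + 2 * y x * y' + 2 * h x * h')) x := by
    refine (((hD.add (hy.pow 2)).add (hh.pow 2)).const_mul M).congr_deriv ?_
    simp
  have ha : HasDerivAt (fun x => al v (M * (D x + y x ^ 2 + h x ^ 2)))
      (alr v (M * (D x + y x ^ 2 + h x ^ 2)) * (M * (D' + 2 * y x * y' + 2 * h x * h'))) x := by
    unfold al alr
    have := (rho_hasDerivAt ((v ^ 2 - 1) ^ 2 + M * (D x + y x ^ 2 + h x ^ 2))).comp x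
      (hr.const_add ((v ^ 2 - 1) ^ 2))
    refine ((this.const_mul (q v)).const_mul (Real.pi / 2)).congr_deriv ?_
    ring
  unfold KK
  refine ((hh.mul ha.cos).add (hy.mul ha.sin)).congr_deriv ?_
  simp only [Kh, Ky, KD, NN]
  ring

lemma KK_neg (M D y v h : ℝ) : KK M D y (-v) (-h) = - KK M D y v h := by
  simp only [KK, neg_sq, al_neg, Real.cos_neg, Real.sin_neg]; ring
lemma Kh_neg (M D y v h : ℝ) : Kh M D y (-v) (-h) = Kh M D y v h := by
  simp only [Kh, NN, neg_sq, al_neg, alr_neg, Real.cos_neg, Real.sin_neg]; ring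
lemma Ky_neg (M D y v h : ℝ) : Ky M D y (-v) (-h) = - Ky M D y v h := by
  simp only [Ky, NN, neg_sq, al_neg, alr_neg, Real.cos_neg, Real.sin_neg]; ring
lemma KD_neg (M D y v h : ℝ) : KD M D y (-v) (-h) = - KD M D y v h := by
  simp only [KD, NN, neg_sq, al_neg, alr_neg, Real.cos_neg, Real.sin_neg]; ring

section zero
variable {M D y v : ℝ}

lemma r_nonneg (hM : 0 < M) (hD : 0 ≤ D) (h : ℝ) : 0 ≤ M * (D + y ^ 2 + h ^ 2) := by positivity

lemma KK_zero_sq (hM : 0 < M) (hD : 0 ≤ D) {h : ℝ} (h0 : KK M D y v h = 0) :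
    h ^ 2 * (1 - Real.sin (al v (M * (D + y ^ 2 + h ^ 2))) ^ 2) =
      y ^ 2 * Real.sin (al v (M * (D + y ^ 2 + h ^ 2))) ^ 2 := by
  have := Real.sin_sq_add_cos_sq (al v (M * (D + y ^ 2 + h ^ 2)))
  unfold KK at h0
  rw [show 1 - Real.sin (al v (M * (D + y ^ 2 + h ^ 2))) ^ 2 =
    Real.cos (al v (M * (D + y ^ 2 + h ^ 2))) ^ 2 by linarith]
  rw [← mul_pow, ← mul_pow, show h * Real.cos (al v (M * (D + y ^ 2 + h ^ 2))) =
    - (y * Real.sin (al v (M * (D + y ^ 2 + h ^ 2)))) by linarith, neg_sq]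

lemma zero_of_core (hM : 0 < M) (hD : 0 ≤ D) {h : ℝ} (hc : Real.cos (al v (M * (D + y ^ 2 + h ^ 2))) = 0) :
    v ^ 2 = 1 ∧ D = 0 ∧ y = 0 ∧ h = 0 := by
  obtain ⟨h1, h2⟩ := core_of_cos (r_nonneg hM hD h) hc
  have h3 : D + y ^ 2 + h ^ 2 = 0 := by
    rcases mul_eq_zero.1 h2 with h | h
    · exact absurd h hM.ne'
    · exact h
  have : y ^ 2 = 0 := by nlinarith [sq_nonneg y, sq_nonneg h]
  have : h ^ 2 = 0 := by nlinarith [sq_nonneg y, sq_nonneg h]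
  refine ⟨h1, by nlinarith, by simpa using ‹y ^ 2 = 0›, by simpa using this⟩

lemma KK_zero_sq_le (hM : 0 < M) (hD : 0 ≤ D) {h₁ h₂ : ℝ} (h1 : KK M D y v h₁ = 0) (h2 : KK M D y v h₂ = 0)
    (hle : h₁ ^ 2 ≤ h₂ ^ 2) : h₁ ^ 2 = h₂ ^ 2 := by
  by_cases hc : Real.cos (al v (M * (D + y ^ 2 + h₂ ^ 2))) = 0
  · obtain ⟨_, _, _, h⟩ := zero_of_core hM hD hc
    subst h; nlinarith [sq_nonneg h₁]
  have e1 := KK_zero_sq hM hD h1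
  have e2 := KK_zero_sq hM hD h2
  have hs := sin_sq_mono (v := v) (r_nonneg hM hD h₁ (y := y))
    (show M * (D + y ^ 2 + h₁ ^ 2) ≤ M * (D + y ^ 2 + h₂ ^ 2) by gcongr)
  have hcs : 0 < 1 - Real.sin (al v (M * (D + y ^ 2 + h₂ ^ 2))) ^ 2 := by
    have := Real.sin_sq_add_cos_sq (al v (M * (D + y ^ 2 + h₂ ^ 2)))
    have : 0 < Real.cos (al v (M * (D + y ^ 2 + h₂ ^ 2))) ^ 2 := by positivity
    linarith
  have hk : h₂ ^ 2 * (1 - Real.sin (al v (M * (D + y ^ 2 + h₂ ^ 2))) ^ 2) ≤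
      h₁ ^ 2 * (1 - Real.sin (al v (M * (D + y ^ 2 + h₂ ^ 2))) ^ 2) := by
    rw [e2]
    refine le_trans (mul_le_mul_of_nonneg_left hs (sq_nonneg y)) ?_
    rw [← e1]
    exact mul_le_mul_of_nonneg_left (by linarith) (sq_nonneg _)
  exact le_antisymm hle (le_of_mul_le_mul_right hk hcs)

lemma KK_zero_unique (hM : 0 < M) (hD : 0 ≤ D) {h₁ h₂ : ℝ} (h1 : KK M D y v h₁ = 0) (h2 : KK M D y v h₂ = 0) : h₁ = h₂ := by
  have hsq : h₁ ^ 2 = h₂ ^ 2 := by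
    rcases le_total (h₁ ^ 2) (h₂ ^ 2) with h | h
    · exact KK_zero_sq_le hM hD h1 h2 h
    · exact (KK_zero_sq_le hM hD h2 h1 h).symm
  by_cases hc : Real.cos (al v (M * (D + y ^ 2 + h₂ ^ 2))) = 0
  · obtain ⟨_, _, _, h⟩ := zero_of_core hM hD hc
    subst h; simpa using hsq
  · unfold KK at h1 h2
    rw [hsq] at h1
    exact mul_right_cancel₀ hc (by linarith)

lemma Kh_pos (hM : 0 < M) (hD : 0 ≤ D) {h : ℝ} (h0 : KK M D y v h = 0)
    (hn : ¬ (v ^ 2 = 1 ∧ D = 0 ∧ y = 0)) : 0 < Kh M D y v h := by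
  have hc : 0 < Real.cos (al v (M * (D + y ^ 2 + h ^ 2))) := by
    refine lt_of_le_of_ne (cos_al_nonneg (r_nonneg hM hD h)) fun hc => hn ?_
    obtain ⟨a, b, c, _⟩ := zero_of_core hM hD hc.symm
    exact ⟨a, b, c⟩
  have hs := q_mul_sin_nonneg (v := v) (r_nonneg hM hD h (y := y))
  have hN : NN M D y v h * h = - (h ^ 2 + y ^ 2) * Real.sin (al v (M * (D + y ^ 2 + h ^ 2))) := by
    unfold NN; unfold KK at h0
    linear_combination y * h0
  have hd := rho_deriv_nonpos ((v ^ 2 - 1) ^ 2 + M * (D + y ^ 2 + h ^ 2))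
  have e : Kh M D y v h = Real.cos (al v (M * (D + y ^ 2 + h ^ 2))) +
      (Real.pi * M * (h ^ 2 + y ^ 2)) * (q v * Real.sin (al v (M * (D + y ^ 2 + h ^ 2)))) *
      (- deriv rho ((v ^ 2 - 1) ^ 2 + M * (D + y ^ 2 + h ^ 2))) := by
    unfold Kh alr
    linear_combination (Real.pi * M * q v * deriv rho ((v ^ 2 - 1) ^ 2 + M * (D + y ^ 2 + h ^ 2))) * hN
  rw [e]
  have := Real.pi_pos
  have : 0 ≤ (Real.pi * M * (h ^ 2 + y ^ 2)) *
    (q v * Real.sin (al v (M * (D + y ^ 2 + h ^ 2)))) *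
      (- deriv rho ((v ^ 2 - 1) ^ 2 + M * (D + y ^ 2 + h ^ 2))) :=
    mul_nonneg (mul_nonneg (by positivity) hs) (by linarith)
  linarith

lemma KK_of_large (hM : 0 < M) (hD : 0 ≤ D) {h : ℝ} (hl : 1 ≤ (v ^ 2 - 1) ^ 2 + M * (D + y ^ 2 + h ^ 2)) :
    KK M D y v h = h := by
  simp [KK, al_zero_of_le hl]

end zero

lemma rho_continuous : Continuous rho := rho_contDiff.continuous
lemma rho_deriv_continuous : Continuous (deriv rho) := rho_contDiff.continuous_deriv (by simp)

lemma KK_continuous (M D y : ℝ) : Continuous fun x : ℝ × ℝ => KK M D y x.1 x.2 := by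
  have := rho_continuous
  unfold KK al q; fun_prop
lemma Kh_continuous (M D y : ℝ) : Continuous fun x : ℝ × ℝ => Kh M D y x.1 x.2 := by
  have := rho_continuous; have := rho_deriv_continuous
  unfold Kh NN alr al q; fun_prop
lemma Ky_continuous (M D y : ℝ) : Continuous fun x : ℝ × ℝ => Ky M D y x.1 x.2 := by
  have := rho_continuous; have := rho_deriv_continuous
  unfold Ky NN alr al q; fun_prop
lemma KD_continuous (M D y : ℝ) : Continuous fun x : ℝ × ℝ => KD M D y x.1 x.2 := by
  have := rho_continuous; have := rho_deriv_continuous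
  unfold KD NN alr al q; fun_prop

section zero
variable {M D y v : ℝ}

/-- bound beyond which the profile is trivial -/
lemma KK_exists_zero (hM : 0 < M) (hD : 0 ≤ D) : ∃ h, KK M D y v h = 0 := by
  set L : ℝ := 1 + 1 / M with hL
  have hLp : 0 < L := by positivity
  have hbig : 1 ≤ M * L ^ 2 := by
    have : M * L ^ 2 = M + 2 + 1 / M := by rw [hL]; field_simp; ring
    rw [this]; have : 0 < 1 / M := by positivity
    linarith
  have hl : ∀ h : ℝ, h ^ 2 = L ^ 2 → KK M D y v h = h := fun h hh => by
    apply KK_of_large hM hD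
    rw [hh]; nlinarith [sq_nonneg (v ^ 2 - 1), mul_nonneg hM.le hD, mul_nonneg hM.le (sq_nonneg y)]
  have hcont : Continuous fun h => KK M D y v h :=
    (KK_continuous M D y).comp (by fun_prop : Continuous fun h : ℝ => (v, h))
  have := intermediate_value_Icc (show -L ≤ L by linarith) hcont.continuousOn
  rw [hl L rfl, hl (-L) (by ring)] at this
  obtain ⟨h, _, hh⟩ := this (show (0:ℝ) ∈ Icc (-L) L from ⟨by linarith, hLp.le⟩)
  exact ⟨h, hh⟩

end zero

/-- the height of the level set -/
def eta (M D y v : ℝ) : ℝ := Classical.epsilon fun h => KK M D y v h = 0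

section zero
variable {M D y v : ℝ}

lemma eta_spec (hM : 0 < M) (hD : 0 ≤ D) : KK M D y v (eta M D y v) = 0 :=
  Classical.epsilon_spec (p := fun h => KK M D y v h = 0) (KK_exists_zero hM hD)

lemma eta_eq (hM : 0 < M) (hD : 0 ≤ D) {h : ℝ} (h0 : KK M D y v h = 0) : h = eta M D y v :=
  KK_zero_unique hM hD h0 (eta_spec hM hD)

lemma eta_neg (hM : 0 < M) (hD : 0 ≤ D) : eta M D y (-v) = - eta M D y v :=
  (eta_eq hM hD (by rw [KK_neg, eta_spec hM hD, neg_zero])).symm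

lemma KK_pos_of_gt (hM : 0 < M) (hD : 0 ≤ D) {h : ℝ} (hh : eta M D y v < h) : 0 < KK M D y v h := by
  by_contra hcon
  push Not at hcon
  set L : ℝ := |h| + 1 + 1 / M with hL
  have h1M : 0 < 1 / M := by positivity
  have hLh : h < L := by linarith [le_abs_self h]
  have hLp : 0 < L := by positivity
  have hbig : 1 ≤ M * L ^ 2 := by
    have : (1 + 1 / M) ^ 2 ≤ L ^ 2 := by
      have := abs_nonneg h
      gcongr; linarith
    have e : M * (1 + 1 / M) ^ 2 = M + 2 + 1 / M := by field_simp; ring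
    have := mul_le_mul_of_nonneg_left this hM.le
    linarith
  have hl : KK M D y v L = L := by
    apply KK_of_large hM hD
    nlinarith [sq_nonneg (v ^ 2 - 1), mul_nonneg hM.le hD, mul_nonneg hM.le (sq_nonneg y)]
  have hcont : Continuous fun h => KK M D y v h :=
    (KK_continuous M D y).comp (by fun_prop : Continuous fun h : ℝ => (v, h))
  have := intermediate_value_Icc hLh.le hcont.continuousOn
  simp only [hl] at this
  obtain ⟨h', hm, hh'⟩ := this (show (0:ℝ) ∈ Icc _ _ from ⟨hcon, hLp.le⟩)
  have := eta_eq hM hD hh'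
  linarith [hm.1]

lemma KK_neg_of_lt (hM : 0 < M) (hD : 0 ≤ D) {h : ℝ} (hh : h < eta M D y v) : KK M D y v h < 0 := by
  have := KK_pos_of_gt (v := -v) (h := -h) (y := y) hM hD (by rw [eta_neg hM hD]; linarith)
  rw [KK_neg] at this; linarith

lemma eta_continuous (hM : 0 < M) (hD : 0 ≤ D) : Continuous (eta M D y) := by
  rw [continuous_iff_continuousAt]
  intro v
  rw [Metric.continuousAt_iff']
  intro ε hε
  have h1 : 0 < KK M D y v (eta M D y v + ε / 2) := KK_pos_of_gt hM hD (by linarith)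
  have h2 : KK M D y v (eta M D y v - ε / 2) < 0 := KK_neg_of_lt hM hD (by linarith)
  have c : ∀ h, Continuous fun v => KK M D y v h := fun h =>
    (KK_continuous M D y).comp (by fun_prop : Continuous fun v : ℝ => (v, h))
  filter_upwards [(c (eta M D y v + ε / 2)).continuousAt.eventually_mem (Ioi_mem_nhds h1),
    (c (eta M D y v - ε / 2)).continuousAt.eventually_mem (Iio_mem_nhds h2)] with w hw1 hw2
  have a1 : eta M D y w ≤ eta M D y v + ε / 2 := by
    by_contra hcon; push Not at hcon
    have := KK_neg_of_lt hM hD hcon; simp only [mem_Ioi] at hw1; linarith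
  have a2 : eta M D y v - ε / 2 ≤ eta M D y w := by
    by_contra hcon; push Not at hcon
    have := KK_pos_of_gt hM hD hcon; simp only [mem_Iio] at hw2; linarith
  rw [Real.dist_eq, abs_lt]; constructor <;> linarith

end zero

/-- displacement densities -/
def gy (M D y v : ℝ) : ℝ := Ky M D y v (eta M D y v) / Kh M D y v (eta M D y v)
def gD (M D y v : ℝ) : ℝ := KD M D y v (eta M D y v) / Kh M D y v (eta M D y v)
/-- base point of the displacement integrals -/
def base (D y v : ℝ) : ℝ :=
  if D = 0 ∧ y = 0 then (if v < -1 then -2 else if v < 1 then 0 else 2) else -2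
def Ay (M D y v : ℝ) : ℝ := ∫ x in (base D y v)..v, gy M D y x
def AD (M D y v : ℝ) : ℝ := ∫ x in (base D y v)..v, gD M D y x

section zero
variable {M D y : ℝ}

lemma gy_neg (hM : 0 < M) (hD : 0 ≤ D) (v : ℝ) : gy M D y (-v) = - gy M D y v := by
  rw [gy, eta_neg hM hD, Ky_neg, Kh_neg, gy, neg_div]
lemma gD_neg (hM : 0 < M) (hD : 0 ≤ D) (v : ℝ) : gD M D y (-v) = - gD M D y v := by
  rw [gD, eta_neg hM hD, KD_neg, Kh_neg, gD, neg_div]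

lemma Kh_eta_continuous (hM : 0 < M) (hD : 0 ≤ D) : Continuous fun v => Kh M D y v (eta M D y v) :=
  Continuous.comp (g := fun x : ℝ × ℝ => Kh M D y x.1 x.2) (f := fun v => (v, eta M D y v))
    (Kh_continuous M D y) (continuous_id.prodMk (eta_continuous hM hD))

lemma gy_continuousAt (hM : 0 < M) (hD : 0 ≤ D) {v : ℝ} (hn : ¬ (v ^ 2 = 1 ∧ D = 0 ∧ y = 0)) :
    ContinuousAt (gy M D y) v := by
  refine ContinuousAt.div ?_ (Kh_eta_continuous hM hD).continuousAt
    (Kh_pos hM hD (eta_spec hM hD) hn).ne'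
  exact (Continuous.comp (g := fun x : ℝ × ℝ => Ky M D y x.1 x.2) (f := fun v => (v, eta M D y v))
    (Ky_continuous M D y) (continuous_id.prodMk (eta_continuous hM hD))).continuousAt
lemma gD_continuousAt (hM : 0 < M) (hD : 0 ≤ D) {v : ℝ} (hn : ¬ (v ^ 2 = 1 ∧ D = 0 ∧ y = 0)) :
    ContinuousAt (gD M D y) v := by
  refine ContinuousAt.div ?_ (Kh_eta_continuous hM hD).continuousAt
    (Kh_pos hM hD (eta_spec hM hD) hn).ne'
  exact (Continuous.comp (g := fun x : ℝ × ℝ => KD M D y x.1 x.2) (f := fun v => (v, eta M D y v))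
    (KD_continuous M D y) (continuous_id.prodMk (eta_continuous hM hD))).continuousAt

lemma g_zero (hM : 0 < M) (hD : 0 ≤ D) {v : ℝ} (hl : 1 ≤ (v ^ 2 - 1) ^ 2 + M * (D + y ^ 2)) :
    gy M D y v = 0 ∧ gD M D y v = 0 := by
  have h2 : 1 ≤ (v ^ 2 - 1) ^ 2 + M * (D + y ^ 2 + eta M D y v ^ 2) := by
    nlinarith [mul_nonneg hM.le (sq_nonneg (eta M D y v))]
  simp [gy, gD, Ky, KD, al_zero_of_le h2, alr_zero_of_le h2]

end zero

/-- abstract version: integrals of an odd density from the base point -/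
lemma base_integral_hasDerivAt {D y v : ℝ} {g : ℝ → ℝ}
    (hc : ∀ v, ¬ (v ^ 2 = 1 ∧ D = 0 ∧ y = 0) → ContinuousAt g v)
    (hn : ¬ (v ^ 2 = 1 ∧ D = 0 ∧ y = 0)) :
    HasDerivAt (fun v => ∫ x in (base D y v)..v, g x) (g v) v := by
  have key : ∀ b : ℝ, (∀ᶠ w in 𝓝 v, base D y w = b) →
      (∀ x ∈ uIcc b v, ¬ (x ^ 2 = 1 ∧ D = 0 ∧ y = 0)) →
      HasDerivAt (fun v => ∫ x in (base D y v)..v, g x) (g v) v := by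
    intro b hb hx
    have hco : ContinuousOn g (uIcc b v) := fun x hxm => (hc x (hx x hxm)).continuousWithinAt
    have hmeas : StronglyMeasurableAtFilter g (𝓝 v) := by
      have hopen : IsOpen {v : ℝ | ¬ (v ^ 2 = 1 ∧ D = 0 ∧ y = 0)} := by
        by_cases hDy : D = 0 ∧ y = 0
        · simp only [hDy, and_true]
          exact isOpen_ne_fun (by fun_prop) continuous_const
        · have : {v : ℝ | ¬ (v ^ 2 = 1 ∧ D = 0 ∧ y = 0)} = univ := by
            ext; simp only [mem_ofPred_eq, mem_univ, iff_true]; tauto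
          rw [this]; exact isOpen_univ
      exact ContinuousOn.stronglyMeasurableAtFilter hopen
        (fun x hx => (hc x hx).continuousWithinAt) v hn
    have := intervalIntegral.integral_hasDerivAt_right hco.intervalIntegrable hmeas (hc v hn)
    refine this.congr_of_eventuallyEq ?_
    filter_upwards [hb] with w hw
    rw [hw]
  by_cases hDy : D = 0 ∧ y = 0
  · have hv : v ^ 2 ≠ 1 := fun h => hn ⟨h, hDy⟩
    have hv1 : v ≠ 1 := fun h => hv (by rw [h]; norm_num)
    have hv2 : v ≠ -1 := fun h => hv (by rw [h]; norm_num)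
    simp only [hDy, and_true, base, if_true] at key ⊢
    rcases lt_or_gt_of_ne hv2 with h | h
    · refine key (-2) ?_ ?_
      · filter_upwards [Iio_mem_nhds h] with w hw
        simp only [mem_Iio] at hw; simp [hw]
      · intro x hx h1
        have : x ≤ max (-2) v := hx.2
        have : max (-2) v < -1 := max_lt (by norm_num) h
        nlinarith
    · rcases lt_or_gt_of_ne hv1 with h' | h'
      · refine key 0 ?_ ?_
        · filter_upwards [Ioo_mem_nhds h h'] with w hw
          rw [if_neg (by linarith [hw.1]), if_pos hw.2]
        · intro x hx h1
          have h3 : x ≤ max 0 v := hx.2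
          have h4 : max 0 v < 1 := max_lt (by norm_num) h'
          have h5 : min 0 v ≤ x := hx.1
          have h6 : -1 < min 0 v := lt_min (by norm_num) h
          nlinarith
      · refine key 2 ?_ ?_
        · filter_upwards [Ioi_mem_nhds h'] with w hw
          simp only [mem_Ioi] at hw
          rw [if_neg (by linarith), if_neg (by linarith)]
        · intro x hx h1
          have h5 : min 2 v ≤ x := hx.1
          have h6 : 1 < min 2 v := lt_min (by norm_num) h'
          nlinarith
  · refine key (-2) ?_ ?_
    · filter_upwards with w
      simp [base, hDy]
    · intro x _ hx; exact hDy hx.2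

lemma base_integral_zero {D y v : ℝ} {g : ℝ → ℝ}
    (hc : ∀ v, ¬ (v ^ 2 = 1 ∧ D = 0 ∧ y = 0) → ContinuousAt g v)
    (hodd : ∀ v, g (-v) = - g v) (hz : ∀ v, 2 ≤ v ^ 2 → g v = 0) (hv : 2 ≤ v ^ 2) :
    ∫ x in (base D y v)..v, g x = 0 := by
  have z : ∀ a : ℝ, (∀ x ∈ uIcc a v, 2 ≤ x ^ 2) → ∫ x in a..v, g x = 0 := fun a ha => by
    rw [intervalIntegral.integral_congr (g := fun _ => (0:ℝ)) fun x hx => hz x (ha x hx)]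
    simp
  rcases le_or_gt v 0 with h | h
  · have hv1 : v < -1 := by nlinarith
    have hb : base D y v = -2 := by unfold base; split_ifs <;> rfl
    rw [hb]
    apply z
    intro x hx
    rcases le_total v (-2) with h' | h'
    · rw [uIcc_of_ge h'] at hx
      nlinarith [hx.1, hx.2]
    · rw [uIcc_of_le h'] at hx
      nlinarith [hx.1, hx.2]
  · have hv1 : 1 < v := by nlinarith
    have z2 : ∫ x in (2:ℝ)..v, g x = 0 := by
      apply z
      intro x hx
      rcases le_total v 2 with h' | h'
      · rw [uIcc_of_ge h'] at hx
        nlinarith [hx.1, hx.2]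
      · rw [uIcc_of_le h'] at hx
        nlinarith [hx.1, hx.2]
    by_cases hDy : D = 0 ∧ y = 0
    · have hb : base D y v = 2 := by
        simp only [base, hDy, and_true, if_true]
        rw [if_neg (by linarith), if_neg (by linarith)]
      rw [hb, z2]
    · have hb : base D y v = -2 := by simp [base, hDy]
      have hcont : Continuous g := continuous_iff_continuousAt.2 fun x => hc x fun h => hDy h.2
      rw [hb, ← intervalIntegral.integral_add_adjacent_intervals (b := 2)
        (hcont.intervalIntegrable _ _) (hcont.intervalIntegrable _ _), z2, add_zero]
      have h1 : ∫ x in (-2:ℝ)..2, g (-x) = ∫ x in (-2:ℝ)..2, g x := by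
        rw [intervalIntegral.integral_comp_neg]; simp
      simp only [hodd, intervalIntegral.integral_neg] at h1
      linarith

section zero
variable {M D y v : ℝ}

lemma Ay_hasDerivAt (hM : 0 < M) (hD : 0 ≤ D) (hn : ¬ (v ^ 2 = 1 ∧ D = 0 ∧ y = 0)) :
    HasDerivAt (Ay M D y) (gy M D y v) v :=
  base_integral_hasDerivAt (fun _ h => gy_continuousAt hM hD h) hn
lemma AD_hasDerivAt (hM : 0 < M) (hD : 0 ≤ D) (hn : ¬ (v ^ 2 = 1 ∧ D = 0 ∧ y = 0)) :
    HasDerivAt (AD M D y) (gD M D y v) v :=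
  base_integral_hasDerivAt (fun _ h => gD_continuousAt hM hD h) hn

lemma Ay_zero (hM : 0 < M) (hD : 0 ≤ D) (h : 2 ≤ v ^ 2 ∨ 1 ≤ M * (D + y ^ 2)) : Ay M D y v = 0 ∧ AD M D y v = 0 := by
  have hp : 0 ≤ M * (D + y ^ 2) := by positivity
  rcases h with h | h
  · exact ⟨base_integral_zero (fun _ h => gy_continuousAt hM hD h) (gy_neg hM hD)
      (fun v hv => (g_zero hM hD (by nlinarith)).1) h,
      base_integral_zero (fun _ h => gD_continuousAt hM hD h) (gD_neg hM hD)
      (fun v hv => (g_zero hM hD (by nlinarith)).2) h⟩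
  · have := fun v : ℝ => g_zero (v := v) (y := y) hM hD (by nlinarith [sq_nonneg (v ^ 2 - 1)])
    simp [Ay, AD, this]

end zero

end Plug

namespace Plug
set_option linter.unusedSectionVars false

/-! ### Geometry of the plugs -/

def om (l : Fin n) : ℝ := 1 + (l : ℝ) * √2
def W (n : ℕ) : ℝ := ∑ l : Fin n, om l
def pp (n : ℕ) : ℝ := 1 / (5 * W n)
def mm (n : ℕ) : ℝ := pp n ^ 2 / (4 * (1 + W n))
def MM (n : ℕ) : ℝ := 2 / mm n ^ 2
def Q (z : Esp n) : ℝ := ∑ l, om l * ‖z l‖ ^ 2 / 2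
/-- an auxiliary index different from `j` -/
def kz (j : Fin n) : Fin n := @Classical.epsilon _ ⟨j⟩ (fun k => k ≠ j)
def th (j : Fin n) (z : Esp n) : ℝ := (z j).arg
def EE (j k : Fin n) (z : Esp n) : ℂ :=
  (pp n : ℂ) * Complex.exp (((om k / om j * th j z : ℝ) : ℂ) * Complex.I)
def dd (j k : Fin n) (z : Esp n) : ℝ :=
  if k = j then 0 else (‖z k - EE j k z‖ ^ 2 - pp n ^ 2) / 2
def yy (j : Fin n) (z : Esp n) : ℝ := ∑ k, om k * dd j k z
def D2 (j : Fin n) (z : Esp n) : ℝ := ∑ k, if k = kz j then 0 else dd j k z ^ 2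
def hh (z : Esp n) : ℝ := Q z - 1
def vv (j : Fin n) (z : Esp n) : ℝ := 2 * th j z
def rr (j : Fin n) (z : Esp n) : ℝ := MM n * (D2 j z + yy j z ^ 2 + hh z ^ 2)
def aa (j : Fin n) (z : Esp n) : ℝ := al (vv j z) (rr j z)
def OO (j : Fin n) : Set (Esp n) := {z | 0 < (z j).re ∧ vv j z ^ 2 < 9 / 4 ∧ rr j z < 2}
def CC (j : Fin n) : Set (Esp n) := {z | 0 < (z j).re ∧ vv j z ^ 2 ≤ 2 ∧ rr j z ≤ 1}
def h1 (j : Fin n) (s : ℝ) (z : Esp n) : ℝ :=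
  hh z * Real.cos (s * aa j z) + yy j z * Real.sin (s * aa j z)
def y1 (j : Fin n) (s : ℝ) (z : Esp n) : ℝ :=
  -hh z * Real.sin (s * aa j z) + yy j z * Real.cos (s * aa j z)
def f1 (j : Fin n) (s : ℝ) (z : Esp n) : ℝ :=
  √((pp n ^ 2 + 2 * dd j (kz j) z + 2 * (y1 j s z - yy j z) / om (kz j)) /
    (pp n ^ 2 + 2 * dd j (kz j) z))
def zk (j : Fin n) (s : ℝ) (z : Esp n) : ℂ :=
  EE j (kz j) z + (f1 j s z : ℂ) * (z (kz j) - EE j (kz j) z)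
def f2 (j : Fin n) (s : ℝ) (z : Esp n) : ℝ :=
  √(1 + (2 * (h1 j s z - hh z) - om (kz j) * (‖zk j s z‖ ^ 2 - ‖z (kz j)‖ ^ 2)) /
    (om j * ‖z j‖ ^ 2))
def GG (j : Fin n) (s : ℝ) (z : Esp n) : Esp n :=
  WithLp.toLp 2 (fun l => if l = kz j then zk j s z else if l = j then (f2 j s z : ℂ) * z j else z l)

lemma om_pos (l : Fin n) : 0 < om l := by unfold om; positivity
lemma om_ge (l : Fin n) : 1 ≤ om l := by
  unfold om; have : 0 ≤ (l : ℝ) * √2 := by positivity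
  linarith
lemma om_le_W (l : Fin n) : om l ≤ W n :=
  Finset.single_le_sum (f := fun l : Fin n => om l) (fun i _ => (om_pos i).le) (Finset.mem_univ l)

variable [hn3 : Fact (3 ≤ n)]

lemma kz_ne (j : Fin n) : kz j ≠ j := by
  have : Nontrivial (Fin n) := Fin.nontrivial_iff_two_le.2 (le_trans (by norm_num) hn3.out)
  exact @Classical.epsilon_spec _ (fun k => k ≠ j) (exists_ne j)

lemma W_ge : 1 ≤ W n := by
  have : 0 < n := lt_of_lt_of_le (by norm_num) hn3.out
  exact le_trans (om_ge ⟨0, this⟩) (om_le_W _)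
lemma pp_pos : 0 < pp n := by have := W_ge (n := n); unfold pp; positivity
lemma W_pp : W n * pp n = 1 / 5 := by
  have := W_ge (n := n); unfold pp; field_simp
lemma pp_le : pp n ≤ 1 / 5 := by
  have := W_ge (n := n); have := W_pp (n := n); have := pp_pos (n := n); nlinarith
lemma mm_pos : 0 < mm n := by
  have := W_ge (n := n); have := pp_pos (n := n); unfold mm; positivity
lemma mm_W : mm n * (1 + W n) = pp n ^ 2 / 4 := by
  have := W_ge (n := n); unfold mm; field_simp
lemma mm_le : mm n ≤ 1 / 100 := by
  have := W_ge (n := n); have := mm_W (n := n); have := pp_pos (n := n)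
  have := pp_le (n := n); have := mm_pos (n := n); nlinarith
lemma mm_le_pp : mm n ≤ pp n ^ 2 / 4 := by
  have := W_ge (n := n); have := mm_W (n := n); have := mm_pos (n := n); nlinarith
lemma MM_pos : 0 < MM n := by have := mm_pos (n := n); unfold MM; positivity

lemma D2_nonneg (j : Fin n) (z : Esp n) : 0 ≤ D2 j z :=
  Finset.sum_nonneg fun k _ => by split_ifs <;> positivity
lemma rr_nonneg (j : Fin n) (z : Esp n) : 0 ≤ rr j z := by
  have := D2_nonneg j z; have := MM_pos (n := n); unfold rr; positivity

lemma CC_subset_OO (j : Fin n) : CC j ⊆ OO (n := n) j := fun z h => ⟨h.1, by linarith [h.2.1], by linarith [h.2.2]⟩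

lemma norm_EE (j k : Fin n) (z : Esp n) : ‖EE j k z‖ = pp n := by
  rw [EE, norm_mul, Complex.norm_exp_ofReal_mul_I, mul_one, Complex.norm_real,
    Real.norm_of_nonneg pp_pos.le]

lemma norm_sq_dd {j k : Fin n} (h : k ≠ j) (z : Esp n) :
    ‖z k - EE j k z‖ ^ 2 = pp n ^ 2 + 2 * dd j k z := by
  simp [dd, h]; ring

lemma sum_small {j : Fin n} {z : Esp n} (h : rr j z < 2) :
    D2 j z + yy j z ^ 2 + hh z ^ 2 < mm n ^ 2 := by
  have := mm_pos (n := n)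
  unfold rr MM at h
  rw [div_mul_eq_mul_div, div_lt_iff₀ (by positivity)] at h
  linarith

lemma hh_small {j : Fin n} {z : Esp n} (h : rr j z < 2) : |hh z| < mm n := by
  have := sum_small h; have := D2_nonneg j z
  exact abs_lt_of_sq_lt_sq (by nlinarith) mm_pos.le
lemma yy_small {j : Fin n} {z : Esp n} (h : rr j z < 2) : |yy j z| < mm n := by
  have := sum_small h; have := D2_nonneg j z
  exact abs_lt_of_sq_lt_sq (by nlinarith) mm_pos.le

lemma dd_of_bound {j : Fin n} {z : Esp n} (h : D2 j z + yy j z ^ 2 < mm n ^ 2) (k : Fin n) :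
    |dd j k z| ≤ pp n ^ 2 / 4 := by
  have hD := D2_nonneg j z
  have hm := mm_pos (n := n)
  have key : ∀ k, k ≠ kz j → |dd j k z| ≤ mm n := fun k hk => by
    have : dd j k z ^ 2 ≤ D2 j z := by
      have := Finset.single_le_sum (f := fun k => if k = kz j then 0 else dd j k z ^ 2)
        (fun i _ => by split_ifs <;> positivity) (Finset.mem_univ k)
      rw [if_neg hk] at this
      exact this
    exact abs_le_of_sq_le_sq (by nlinarith) hm.le
  by_cases hk : k = kz j
  · have hy : |yy j z| ≤ mm n := abs_le_of_sq_le_sq (by nlinarith) hm.le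
    have e : yy j z = om k * dd j k z + ∑ l ∈ Finset.univ.erase k, om l * dd j l z := by
      exact (Finset.add_sum_erase _ (fun l => om l * dd j l z) (Finset.mem_univ k)).symm
    have e2 : |∑ l ∈ Finset.univ.erase k, om l * dd j l z| ≤ W n * mm n := by
      refine (Finset.abs_sum_le_sum_abs _ _).trans ?_
      calc ∑ l ∈ Finset.univ.erase k, |om l * dd j l z|
          ≤ ∑ l ∈ Finset.univ.erase k, om l * mm n := by
            refine Finset.sum_le_sum fun l hl => ?_
            rw [abs_mul, abs_of_pos (om_pos l)]
            exact mul_le_mul_of_nonneg_left (key l (by rw [← hk]; exact Finset.ne_of_mem_erase hl)) (om_pos l).le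
        _ ≤ ∑ l, om l * mm n := Finset.sum_le_sum_of_subset_of_nonneg (Finset.erase_subset _ _)
            fun l _ _ => mul_nonneg (om_pos l).le hm.le
        _ = W n * mm n := by rw [W, Finset.sum_mul]
    have e3 : om k * |dd j k z| ≤ mm n * (1 + W n) := by
      rw [← abs_of_pos (om_pos k), ← abs_mul, show om k * dd j k z = yy j z -
        ∑ l ∈ Finset.univ.erase k, om l * dd j l z by linarith]
      refine (abs_sub _ _).trans ?_
      linarith
    rw [mm_W] at e3
    nlinarith [om_ge k, abs_nonneg (dd j k z)]
  · exact (key k hk).trans mm_le_pp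

lemma dd_small {j : Fin n} {z : Esp n} (h : rr j z < 2) (k : Fin n) :
    |dd j k z| ≤ pp n ^ 2 / 4 :=
  dd_of_bound (by have := sum_small h; nlinarith [sq_nonneg (hh z)]) k

lemma norm_of_near {a E : ℂ} {p : ℝ} (hE : ‖E‖ = p) (h : ‖a - E‖ ^ 2 ≤ 3 / 2 * p ^ 2) :
    ‖a‖ ^ 2 ≤ 5 * p ^ 2 := by
  have h1 : ‖a‖ ≤ ‖a - E‖ + ‖E‖ := by simpa using norm_add_le (a - E) E
  rw [hE] at h1
  have : ‖a‖ ^ 2 ≤ (‖a - E‖ + p) ^ 2 := by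
    have := norm_nonneg a
    gcongr
  nlinarith [sq_nonneg (‖a - E‖ - p)]

lemma zk_small {j k : Fin n} {z : Esp n} (h : rr j z < 2) (hk : k ≠ j) :
    ‖z k‖ ^ 2 ≤ 5 * pp n ^ 2 := by
  refine norm_of_near (norm_EE j k z) ?_
  rw [norm_sq_dd hk]
  have := abs_le.1 (dd_small h k)
  linarith

lemma om_zk_small {j k : Fin n} {z : Esp n} (h : rr j z < 2) (hk : k ≠ j) :
    om k * ‖z k‖ ^ 2 / 2 ≤ 1 / 10 := by
  have h1 := zk_small h hk
  have h2 := om_le_W k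
  have h3 := W_pp (n := n)
  have h4 := pp_le (n := n)
  have h5 := pp_pos (n := n)
  have h6 := om_pos k
  have : om k * ‖z k‖ ^ 2 ≤ W n * (5 * pp n ^ 2) := mul_le_mul h2 h1 (by positivity) (by linarith)
  nlinarith

lemma Q_eq (j : Fin n) (z : Esp n) :
    Q z = om j * ‖z j‖ ^ 2 / 2 + ∑ k ∈ Finset.univ.erase j, om k * ‖z k‖ ^ 2 / 2 :=
  (Finset.add_sum_erase _ (fun k => om k * ‖z k‖ ^ 2 / 2) (Finset.mem_univ j)).symm

lemma zj_large {j : Fin n} {z : Esp n} (h : rr j z < 2) : 89 / 100 ≤ om j * ‖z j‖ ^ 2 / 2 := by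
  have e := Q_eq j z
  have hq := abs_lt.1 (hh_small h)
  have hm := mm_le (n := n)
  have : ∑ k ∈ Finset.univ.erase j, om k * ‖z k‖ ^ 2 / 2 ≤ 1 / 10 := by
    calc ∑ k ∈ Finset.univ.erase j, om k * ‖z k‖ ^ 2 / 2
        ≤ ∑ k ∈ Finset.univ.erase j, om k * (5 * pp n ^ 2 / 2) := by
          refine Finset.sum_le_sum fun k hk => ?_
          have := zk_small h (Finset.ne_of_mem_erase hk)
          have := om_pos k
          nlinarith
      _ ≤ ∑ k, om k * (5 * pp n ^ 2 / 2) :=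
          Finset.sum_le_sum_of_subset_of_nonneg (Finset.erase_subset _ _)
            fun l _ _ => mul_nonneg (om_pos l).le (by positivity)
      _ = W n * (5 * pp n ^ 2 / 2) := by rw [W, Finset.sum_mul]
      _ = pp n / 2 := by linear_combination (5 * pp n / 2) * W_pp (n := n)
      _ ≤ 1 / 10 := by linarith [pp_le (n := n)]
  unfold hh at hq
  linarith

lemma OO_disjoint {i j : Fin n} {z : Esp n} (hi : z ∈ OO i) (hj : z ∈ OO j) : i = j := by
  by_contra hne
  have := om_zk_small hi.2.2 (Ne.symm hne)
  have := zj_large hj.2.2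
  linarith

lemma zj_ne {j : Fin n} {z : Esp n} (h : 0 < (z j).re) : z j ≠ 0 := fun h0 => by simp [h0] at h

/-! #### Smoothness of the basic functions -/

lemma coord_contDiff (k : Fin n) : ContDiff ℝ (⊤ : ℕ∞) (fun z : Esp n => z k) := by fun_prop

lemma Q_contDiff : ContDiff ℝ (⊤ : ℕ∞) (Q (n := n)) := by
  unfold Q
  refine ContDiff.sum fun k _ => ?_
  exact ((contDiff_const.mul ((coord_contDiff k).norm_sq ℝ)).div_const _)

lemma th_contDiffAt {j : Fin n} {z : Esp n} (h : 0 < (z j).re) :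
    ContDiffAt ℝ (⊤ : ℕ∞) (th j) z := by
  have h1 : ContDiffAt ℝ (⊤ : ℕ∞) (fun z : Esp n => (Complex.log (z j)).im) z := by
    have h2 : ContDiffAt ℝ (⊤ : ℕ∞) Complex.log (z j) :=
      (Complex.contDiffAt_log (Or.inl h)).restrict_scalars ℝ
    have h3 := h2.comp z (coord_contDiff j).contDiffAt
    exact Complex.imCLM.contDiff.contDiffAt.comp z h3
  refine h1.congr_of_eventuallyEq ?_
  filter_upwards with w
  rw [Complex.log_im, th]

lemma EE_contDiffAt {j : Fin n} (k : Fin n) {z : Esp n} (h : 0 < (z j).re) :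
    ContDiffAt ℝ (⊤ : ℕ∞) (EE j k) z := by
  unfold EE
  have := th_contDiffAt h
  have h2 : ContDiffAt ℝ (⊤ : ℕ∞) (fun z : Esp n => ((om k / om j * th j z : ℝ) : ℂ)) z :=
    Complex.ofRealCLM.contDiff.contDiffAt.comp z (contDiffAt_const.mul this)
  exact contDiffAt_const.mul (h2.mul contDiffAt_const).cexp

lemma dd_contDiffAt {j : Fin n} (k : Fin n) {z : Esp n} (h : 0 < (z j).re) :
    ContDiffAt ℝ (⊤ : ℕ∞) (dd j k) z := by
  unfold dd
  split_ifs
  · exact contDiffAt_const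
  · exact (((((coord_contDiff k).contDiffAt.sub (EE_contDiffAt k h))).norm_sq ℝ).sub
      contDiffAt_const).div_const _

lemma yy_contDiffAt {j : Fin n} {z : Esp n} (h : 0 < (z j).re) :
    ContDiffAt ℝ (⊤ : ℕ∞) (yy j) z := by
  unfold yy
  exact ContDiffAt.sum fun k _ => contDiffAt_const.mul (dd_contDiffAt k h)

lemma D2_contDiffAt {j : Fin n} {z : Esp n} (h : 0 < (z j).re) :
    ContDiffAt ℝ (⊤ : ℕ∞) (D2 j) z := by
  unfold D2
  refine ContDiffAt.sum fun k _ => ?_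
  split_ifs
  · exact contDiffAt_const
  · exact (dd_contDiffAt k h).pow 2

lemma hh_contDiff : ContDiff ℝ (⊤ : ℕ∞) (hh (n := n)) := Q_contDiff.sub contDiff_const

lemma vv_contDiffAt {j : Fin n} {z : Esp n} (h : 0 < (z j).re) :
    ContDiffAt ℝ (⊤ : ℕ∞) (vv j) z := contDiffAt_const.mul (th_contDiffAt h)

lemma rr_contDiffAt {j : Fin n} {z : Esp n} (h : 0 < (z j).re) :
    ContDiffAt ℝ (⊤ : ℕ∞) (rr j) z :=
  contDiffAt_const.mul (((D2_contDiffAt h).add ((yy_contDiffAt h).pow 2)).add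
    (hh_contDiff.contDiffAt.pow 2))

lemma aa_contDiffAt {j : Fin n} {z : Esp n} (h : 0 < (z j).re) :
    ContDiffAt ℝ (⊤ : ℕ∞) (aa j) z := by
  have hv := vv_contDiffAt h
  unfold aa al q
  refine contDiffAt_const.mul ((((contDiffAt_const.mul hv).sub (hv.pow 3)).div_const _).mul ?_)
  exact rho_contDiff.contDiffAt.comp z ((((hv.pow 2).sub contDiffAt_const).pow 2).add (rr_contDiffAt h))

lemma OO_isOpen (j : Fin n) : IsOpen (OO (n := n) j) := by
  rw [isOpen_iff_eventually]
  rintro z ⟨h1, h2, h3⟩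
  have c : Continuous fun z : Esp n => (z j).re := Complex.continuous_re.comp (coord_contDiff j).continuous
  filter_upwards [c.continuousAt.eventually_mem (Ioi_mem_nhds h1),
    ((vv_contDiffAt h1).pow 2).continuousAt.eventually_mem (Iio_mem_nhds h2),
    (rr_contDiffAt h1).continuousAt.eventually_mem (Iio_mem_nhds h3)] with w a b c
  exact ⟨a, b, c⟩

lemma CC_re {j : Fin n} {z : Esp n} (h : z ∈ CC j) : 1 / (2 * W n) ≤ (z j).re := by
  have h1 := zj_large (CC_subset_OO j h).2.2
  have hW := W_ge (n := n)
  have h2 := om_le_W j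
  have hc := Real.one_sub_sq_div_two_le_cos (x := (z j).arg)
  have hv := h.2.1
  unfold vv th at hv
  have e : (z j).re = ‖z j‖ * Real.cos (z j).arg := (Complex.norm_mul_cos_arg _).symm
  have h3 : 1 / W n ≤ ‖z j‖ := by
    rw [div_le_iff₀ (by linarith)]
    by_contra hcon
    push Not at hcon
    have h5 : (‖z j‖ * W n) ^ 2 < 1 := by
      have : 0 ≤ ‖z j‖ * W n := by positivity
      nlinarith
    have : om j * ‖z j‖ ^ 2 ≤ W n ^ 2 * ‖z j‖ ^ 2 := by
      apply mul_le_mul_of_nonneg_right _ (by positivity); nlinarith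
    nlinarith
  rw [e]
  have : (1:ℝ) / (2 * W n) = 1 / W n * (1 / 2) := by field_simp
  rw [this]
  exact mul_le_mul h3 (by nlinarith) (by norm_num) (norm_nonneg _)

lemma CC_isClosed (j : Fin n) : IsClosed (CC (n := n) j) := by
  have hW := W_ge (n := n)
  have hp : 0 < 1 / (2 * W n) := by positivity
  have e : CC (n := n) j = {z : Esp n | 1 / (2 * W n) ≤ (z j).re} ∩
      (fun z => (vv j z ^ 2, rr j z)) ⁻¹' (Iic 2 ×ˢ Iic 1) := by
    ext z
    constructor
    · intro h; exact ⟨CC_re h, h.2.1, h.2.2⟩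
    · rintro ⟨h, h2, h3⟩; exact ⟨lt_of_lt_of_le hp h, h2, h3⟩
  rw [e]
  have c : Continuous fun z : Esp n => (z j).re := Complex.continuous_re.comp (coord_contDiff j).continuous
  refine ContinuousOn.preimage_isClosed_of_isClosed ?_ (isClosed_le continuous_const c)
    (isClosed_Iic.prod isClosed_Iic)
  intro z hz
  have hz' : 0 < (z j).re := lt_of_lt_of_le hp hz
  exact (((vv_contDiffAt hz').pow 2).continuousAt.prodMk (rr_contDiffAt hz').continuousAt).continuousWithinAt

lemma aa_zero {j : Fin n} {z : Esp n} (h : z ∈ OO j) (hC : z ∉ CC j) : aa j z = 0 := by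
  apply al_zero_of_le
  have := rr_nonneg j z
  by_contra hcon
  push Not at hcon
  refine hC ⟨h.1, ?_, ?_⟩ <;> nlinarith [sq_nonneg (vv j z ^ 2 - 1)]

end Plug

namespace Plug
set_option linter.unusedSectionVars false
variable [hn3 : Fact (3 ≤ n)]

/-! ### The plug diffeomorphism -/

lemma rot_sq (j : Fin n) (s : ℝ) (z : Esp n) :
    yy j z ^ 2 + hh z ^ 2 = y1 j s z ^ 2 + h1 j s z ^ 2 := by
  unfold y1 h1
  linear_combination -(yy j z ^ 2 + hh z ^ 2) * Real.sin_sq_add_cos_sq (s * aa j z)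

section GG
variable {j : Fin n} {s : ℝ} {z : Esp n}

lemma h1_small (hz : z ∈ OO j) : |h1 j s z| < mm n := by
  have := sum_small hz.2.2; have := D2_nonneg j z; have := rot_sq j s z
  exact abs_lt_of_sq_lt_sq (by nlinarith [sq_nonneg (y1 j s z)]) mm_pos.le
lemma y1_small (hz : z ∈ OO j) : |y1 j s z| < mm n := by
  have := sum_small hz.2.2; have := D2_nonneg j z; have := rot_sq j s z
  exact abs_lt_of_sq_lt_sq (by nlinarith [sq_nonneg (h1 j s z)]) mm_pos.le

lemma den1_pos (hz : z ∈ OO j) : 0 < pp n ^ 2 + 2 * dd j (kz j) z := by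
  have := abs_le.1 (dd_small hz.2.2 (kz j)); have := pp_pos (n := n)
  nlinarith

lemma num1_bound (hz : z ∈ OO j) : 0 < pp n ^ 2 + 2 * dd j (kz j) z + 2 * (y1 j s z - yy j z) / om (kz j) ∧
    pp n ^ 2 + 2 * dd j (kz j) z + 2 * (y1 j s z - yy j z) / om (kz j) ≤ 2 * pp n ^ 2 := by
  have h1 := abs_le.1 (dd_small hz.2.2 (kz j)); have h2 := pp_pos (n := n)
  have h3 := abs_lt.1 (y1_small hz (s := s))
  have h4 := abs_lt.1 (yy_small hz.2.2)
  have h5 := mm_W (n := n)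
  have h6 := W_ge (n := n)
  have h7 := mm_pos (n := n)
  have h8 : mm n ≤ pp n ^ 2 / 8 := by nlinarith
  have h9 : |2 * (y1 j s z - yy j z) / om (kz j)| ≤ pp n ^ 2 / 2 := by
    rw [abs_div, abs_of_pos (om_pos _), div_le_iff₀ (om_pos _)]
    have : |2 * (y1 j s z - yy j z)| ≤ pp n ^ 2 / 2 := by rw [abs_le]; constructor <;> linarith
    nlinarith [om_ge (kz j), sq_nonneg (pp n)]
  have h10 := abs_le.1 h9
  constructor
  · have : |2 * (y1 j s z - yy j z) / om (kz j)| < pp n ^ 2 / 2 := by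
      rw [abs_div, abs_of_pos (om_pos _), div_lt_iff₀ (om_pos _)]
      have : |2 * (y1 j s z - yy j z)| < pp n ^ 2 / 2 := by rw [abs_lt]; constructor <;> linarith
      nlinarith [om_ge (kz j), sq_nonneg (pp n)]
    have := abs_lt.1 this
    linarith
  · linarith

lemma f1_pos (hz : z ∈ OO j) : 0 < (pp n ^ 2 + 2 * dd j (kz j) z + 2 * (y1 j s z - yy j z) / om (kz j)) /
    (pp n ^ 2 + 2 * dd j (kz j) z) := div_pos (num1_bound hz).1 (den1_pos hz)

lemma zk_sub (hz : z ∈ OO j) : ‖zk j s z - EE j (kz j) z‖ ^ 2 =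
    pp n ^ 2 + 2 * dd j (kz j) z + 2 * (y1 j s z - yy j z) / om (kz j) := by
  rw [zk, add_sub_cancel_left, norm_mul, mul_pow, norm_sq_dd (kz_ne j), Complex.norm_real,
    Real.norm_eq_abs, sq_abs, f1, Real.sq_sqrt (f1_pos hz).le, div_mul_cancel₀ _ (den1_pos hz).ne']

lemma om_zk'_small (hz : z ∈ OO j) : om (kz j) * ‖zk j s z‖ ^ 2 ≤ 24 / 100 := by
  have h0 := zk_sub hz (s := s)
  have h1 := (num1_bound hz (s := s)).2
  rw [← h0] at h1
  have h2 : ‖zk j s z‖ ≤ ‖zk j s z - EE j (kz j) z‖ + pp n := by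
    simpa [norm_EE] using norm_add_le (zk j s z - EE j (kz j) z) (EE j (kz j) z)
  have h3 : ‖zk j s z‖ ^ 2 ≤ (‖zk j s z - EE j (kz j) z‖ + pp n) ^ 2 := by gcongr
  have h4 : ‖zk j s z‖ ^ 2 ≤ 6 * pp n ^ 2 := by
    nlinarith [sq_nonneg (‖zk j s z - EE j (kz j) z‖ - pp n)]
  have h5 := om_le_W (kz j)
  have h6 := W_pp (n := n)
  have h7 := pp_le (n := n)
  have h8 := pp_pos (n := n)
  have h9 := om_pos (kz j)
  have : om (kz j) * ‖zk j s z‖ ^ 2 ≤ W n * (6 * pp n ^ 2) := mul_le_mul h5 h4 (by positivity) (by linarith)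
  nlinarith

lemma num2_pos (hz : z ∈ OO j) : 0 < om j * ‖z j‖ ^ 2 + (2 * (h1 j s z - hh z) -
    om (kz j) * (‖zk j s z‖ ^ 2 - ‖z (kz j)‖ ^ 2)) := by
  have h2 := zj_large hz.2.2
  have h3 := om_zk'_small hz (s := s)
  have h4 := abs_lt.1 (h1_small hz (s := s))
  have h5 := abs_lt.1 (hh_small hz.2.2)
  have h6 := mm_le (n := n)
  have h7 : 0 ≤ om (kz j) * ‖z (kz j)‖ ^ 2 := mul_nonneg (om_pos _).le (by positivity)
  nlinarith

lemma den2_pos (hz : z ∈ OO j) : 0 < om j * ‖z j‖ ^ 2 := by linarith [zj_large hz.2.2]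

lemma f2_arg_pos (hz : z ∈ OO j) : 0 < 1 + (2 * (h1 j s z - hh z) - om (kz j) * (‖zk j s z‖ ^ 2 - ‖z (kz j)‖ ^ 2)) /
    (om j * ‖z j‖ ^ 2) := by
  have h := den2_pos hz
  have h2 := num2_pos hz (s := s)
  rw [← div_self h.ne', ← add_div]
  positivity

lemma f2_pos (hz : z ∈ OO j) : 0 < f2 j s z := Real.sqrt_pos.2 (f2_arg_pos hz)

lemma GG_kz (hz : z ∈ OO j) : GG j s z (kz j) = zk j s z := by simp [GG]
lemma GG_j (hz : z ∈ OO j) : GG j s z j = (f2 j s z : ℂ) * z j := by simp [GG, (kz_ne j).symm]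
lemma GG_other (hz : z ∈ OO j) {l : Fin n} (h : l ≠ kz j) (h' : l ≠ j) : GG j s z l = z l := by simp [GG, h, h']

lemma GG_j_norm (hz : z ∈ OO j) : om j * ‖GG j s z j‖ ^ 2 = om j * ‖z j‖ ^ 2 + (2 * (h1 j s z - hh z) -
    om (kz j) * (‖zk j s z‖ ^ 2 - ‖z (kz j)‖ ^ 2)) := by
  have h := den2_pos hz
  rw [GG_j hz, norm_mul, mul_pow, Complex.norm_real, Real.norm_eq_abs, sq_abs, f2,
    Real.sq_sqrt (f2_arg_pos hz).le, mul_left_comm, add_mul, div_mul_cancel₀ _ h.ne', one_mul]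

lemma GG_th (hz : z ∈ OO j) : th j (GG j s z) = th j z := by
  rw [th, GG_j hz, Complex.arg_real_mul _ (f2_pos hz), th]
lemma GG_re (hz : z ∈ OO j) : 0 < (GG j s z j).re := by
  rw [GG_j hz, Complex.re_ofReal_mul]
  exact mul_pos (f2_pos hz) hz.1
lemma GG_EE (hz : z ∈ OO j) (k : Fin n) : EE j k (GG j s z) = EE j k z := by simp only [EE, GG_th hz]
lemma GG_dd (hz : z ∈ OO j) {k : Fin n} (hk : k ≠ kz j) : dd j k (GG j s z) = dd j k z := by
  unfold dd
  split_ifs with h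
  · rfl
  · rw [GG_EE hz, GG_other hz hk h]
lemma GG_dd_kz (hz : z ∈ OO j) : dd j (kz j) (GG j s z) = dd j (kz j) z + (y1 j s z - yy j z) / om (kz j) := by
  have h1 := zk_sub hz (s := s)
  have h2 := norm_sq_dd (kz_ne j) (GG j s z)
  rw [GG_EE hz, GG_kz hz, h1] at h2
  have : 2 * (y1 j s z - yy j z) / om (kz j) = 2 * ((y1 j s z - yy j z) / om (kz j)) := by ring
  linarith
lemma GG_yy (hz : z ∈ OO j) : yy j (GG j s z) = y1 j s z := by
  have h : yy j (GG j s z) - yy j z = y1 j s z - yy j z := by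
    conv_lhs => rw [yy, yy, ← Finset.sum_sub_distrib]
    rw [Finset.sum_eq_single (kz j)]
    · rw [GG_dd_kz hz]
      have := (om_pos (kz j)).ne'
      field_simp; ring
    · intro k _ hk; rw [GG_dd hz hk]; ring
    · simp
  linarith
lemma GG_D2 (hz : z ∈ OO j) : D2 j (GG j s z) = D2 j z := by
  unfold D2
  refine Finset.sum_congr rfl fun k _ => ?_
  split_ifs with h
  · rfl
  · rw [GG_dd hz h]
lemma GG_Q (hz : z ∈ OO j) : Q (GG j s z) = 1 + h1 j s z := by
  have hk := kz_ne j
  have e : ∀ z : Esp n, Q z = om j * ‖z j‖ ^ 2 / 2 + (om (kz j) * ‖z (kz j)‖ ^ 2 / 2 +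
      ∑ k ∈ (Finset.univ.erase j).erase (kz j), om k * ‖z k‖ ^ 2 / 2) := fun z => by
    rw [Q_eq j, ← Finset.add_sum_erase (Finset.univ.erase j) (fun k => om k * ‖z k‖ ^ 2 / 2)
      (Finset.mem_erase.2 ⟨hk, Finset.mem_univ _⟩)]
  have e3 : ∑ k ∈ (Finset.univ.erase j).erase (kz j), om k * ‖GG j s z k‖ ^ 2 / 2 =
      ∑ k ∈ (Finset.univ.erase j).erase (kz j), om k * ‖z k‖ ^ 2 / 2 :=
    Finset.sum_congr rfl fun k hk => by
      simp only [Finset.mem_erase] at hk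
      rw [GG_other hz hk.1 hk.2.1]
  have e4 := e z
  have e5 : hh z = Q z - 1 := rfl
  rw [e, e3, GG_j_norm hz, GG_kz hz]
  linarith
lemma GG_hh (hz : z ∈ OO j) : hh (GG j s z) = h1 j s z := by rw [hh, GG_Q hz]; ring
lemma GG_vv (hz : z ∈ OO j) : vv j (GG j s z) = vv j z := by rw [vv, GG_th hz, vv]
lemma GG_rr (hz : z ∈ OO j) : rr j (GG j s z) = rr j z := by
  rw [rr, GG_D2 hz, GG_yy hz, GG_hh hz, rr, add_assoc, add_assoc, ← rot_sq]
lemma GG_aa (hz : z ∈ OO j) : aa j (GG j s z) = aa j z := by rw [aa, GG_vv hz, GG_rr hz, aa]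
lemma GG_mem (hz : z ∈ OO j) : GG j s z ∈ OO j := ⟨GG_re hz, by rw [GG_vv hz]; exact hz.2.1, by
  rw [GG_rr hz]; exact hz.2.2⟩

lemma GG_h1 (hz : z ∈ OO j) : h1 j (-s) (GG j s z) = hh z := by
  rw [h1, GG_aa hz, GG_hh hz, GG_yy hz, neg_mul, Real.cos_neg, Real.sin_neg]
  unfold h1 y1
  linear_combination hh z * Real.sin_sq_add_cos_sq (s * aa j z)
lemma GG_y1 (hz : z ∈ OO j) : y1 j (-s) (GG j s z) = yy j z := by
  rw [y1, GG_aa hz, GG_hh hz, GG_yy hz, neg_mul s, Real.cos_neg, Real.sin_neg]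
  unfold h1 y1
  linear_combination yy j z * Real.sin_sq_add_cos_sq (s * aa j z)

lemma GG_zk (hz : z ∈ OO j) : zk j (-s) (GG j s z) = z (kz j) := by
  have a := num1_bound hz (s := s)
  have b := den1_pos hz
  have e : f1 j (-s) (GG j s z) * f1 j s z = 1 := by
    rw [f1, f1, GG_y1 hz, GG_yy hz, GG_dd_kz hz, ← Real.sqrt_mul']
    · rw [Real.sqrt_eq_one]
      have h1 : pp n ^ 2 + 2 * (dd j (kz j) z + (y1 j s z - yy j z) / om (kz j)) =
        pp n ^ 2 + 2 * dd j (kz j) z + 2 * (y1 j s z - yy j z) / om (kz j) := by ring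
      rw [h1, show pp n ^ 2 + 2 * dd j (kz j) z + 2 * (y1 j s z - yy j z) / om (kz j) +
        2 * (yy j z - y1 j s z) / om (kz j) = pp n ^ 2 + 2 * dd j (kz j) z by ring,
        div_mul_div_comm, mul_comm, div_self]
      exact (mul_pos a.1 b).ne'
    · exact (f1_pos hz).le
  rw [zk, GG_EE hz, GG_kz hz, zk, add_sub_cancel_left, ← mul_assoc, ← Complex.ofReal_mul, e]
  simp

lemma GG_f2 (hz : z ∈ OO j) : f2 j (-s) (GG j s z) * f2 j s z = 1 := by
  rw [f2, GG_h1 hz, GG_zk hz, GG_hh hz, GG_kz hz, GG_j_norm hz, f2, ← Real.sqrt_mul' _ (f2_arg_pos hz).le,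
    Real.sqrt_eq_one]
  have h1 := num2_pos hz (s := s)
  have h2 := den2_pos hz
  set A := om j * ‖z j‖ ^ 2
  set B := (2 * (Plug.h1 j s z - hh z) - om (kz j) * (‖zk j s z‖ ^ 2 - ‖z (kz j)‖ ^ 2)) with hB
  have : (2 * (hh z - Plug.h1 j s z) - om (kz j) * (‖z (kz j)‖ ^ 2 - ‖zk j s z‖ ^ 2)) = -B := by
    rw [hB]; ring
  rw [this]
  field_simp
  ring

lemma GG_GG (hz : z ∈ OO j) : GG j (-s) (GG j s z) = z := by
  ext l
  by_cases h : l = kz j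
  · subst h
    rw [GG_kz (GG_mem hz), GG_zk hz]
  · by_cases h' : l = j
    · subst h'
      rw [GG_j (GG_mem hz), GG_j hz, ← mul_assoc, ← Complex.ofReal_mul, GG_f2 hz]; simp
    · rw [GG_other (GG_mem hz) h h', GG_other hz h h']

lemma GG_id (hz : z ∈ OO j) (h0 : aa j z = 0) : GG j s z = z := by
  have e1 : h1 j s z = hh z := by simp [h1, h0]
  have e2 : y1 j s z = yy j z := by simp [y1, h0]
  have e3 : f1 j s z = 1 := by simp [f1, e2, div_self (den1_pos hz).ne']
  have e4 : zk j s z = z (kz j) := by simp [zk, e3]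
  have e5 : f2 j s z = 1 := by simp [f2, e1, e4]
  ext l
  by_cases h : l = kz j
  · subst h; rw [GG_kz hz, e4]
  · by_cases h' : l = j
    · subst h'; rw [GG_j hz, e5]; simp
    · rw [GG_other hz h h']

lemma GG_contDiffAt (hz : z ∈ OO j) : ContDiffAt ℝ (⊤ : ℕ∞) (GG j s) z := by
  have ha := aa_contDiffAt hz.1
  have hy := yy_contDiffAt hz.1
  have hH := (hh_contDiff (n := n)).contDiffAt (x := z)
  have hd := dd_contDiffAt (kz j) hz.1
  have hE := EE_contDiffAt (kz j) hz.1
  have hsa : ContDiffAt ℝ (⊤ : ℕ∞) (fun z => s * aa j z) z := contDiffAt_const.mul ha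
  have hh1 : ContDiffAt ℝ (⊤ : ℕ∞) (h1 j s) z := (hH.mul hsa.cos).add (hy.mul hsa.sin)
  have hy1 : ContDiffAt ℝ (⊤ : ℕ∞) (y1 j s) z := (hH.neg.mul hsa.sin).add (hy.mul hsa.cos)
  have hden : ContDiffAt ℝ (⊤ : ℕ∞) (fun z => pp n ^ 2 + 2 * dd j (kz j) z) z :=
    contDiffAt_const.add (contDiffAt_const.mul hd)
  have hf1 : ContDiffAt ℝ (⊤ : ℕ∞) (f1 j s) z := by
    refine ContDiffAt.sqrt ?_ (f1_pos hz).ne'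
    exact (hden.add ((contDiffAt_const.mul (hy1.sub hy)).div_const _)).div hden (den1_pos hz).ne'
  have hofR : ∀ f : Esp n → ℝ, ContDiffAt ℝ (⊤ : ℕ∞) f z →
      ContDiffAt ℝ (⊤ : ℕ∞) (fun z => (f z : ℂ)) z := fun f hf =>
    Complex.ofRealCLM.contDiff.contDiffAt.comp z hf
  have hzk : ContDiffAt ℝ (⊤ : ℕ∞) (zk j s) z :=
    hE.add ((hofR _ hf1).mul ((coord_contDiff (kz j)).contDiffAt.sub hE))
  have hf2 : ContDiffAt ℝ (⊤ : ℕ∞) (f2 j s) z := by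
    refine ContDiffAt.sqrt ?_ (f2_arg_pos hz).ne'
    refine contDiffAt_const.add (ContDiffAt.div ?_ (contDiffAt_const.mul
      ((coord_contDiff j).contDiffAt.norm_sq ℝ)) (den2_pos hz).ne')
    exact (contDiffAt_const.mul (hh1.sub hH)).sub (contDiffAt_const.mul ((hzk.norm_sq ℝ).sub
      ((coord_contDiff (kz j)).contDiffAt.norm_sq ℝ)))
  refine (contDiffAt_piLp' 2) fun l => ?_
  simp only [GG]
  split_ifs
  · exact hzk
  · exact (hofR _ hf2).mul (coord_contDiff j).contDiffAt
  · exact (coord_contDiff l).contDiffAt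

end GG

/-! #### The global diffeomorphism -/

open Classical in
def DD (s : ℝ) (z : Esp n) : Esp n :=
  if h : ∃ j, z ∈ OO j then GG h.choose s z else z

lemma DD_of_mem {j : Fin n} {z : Esp n} (s : ℝ) (h : z ∈ OO j) : DD s z = GG j s z := by
  have h' : ∃ j, z ∈ OO j := ⟨j, h⟩
  rw [DD, dif_pos h', OO_disjoint h'.choose_spec h]
lemma DD_of_notMem {z : Esp n} (s : ℝ) (h : ∀ j, z ∉ OO j) : DD s z = z := by
  rw [DD, dif_neg (by simpa using h)]
lemma DD_of_notMem_CC {z : Esp n} (s : ℝ) (h : ∀ j, z ∉ CC j) : DD s z = z := by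
  by_cases h' : ∃ j, z ∈ OO j
  · obtain ⟨j, hj⟩ := h'
    rw [DD_of_mem s hj, GG_id hj (aa_zero hj (h j))]
  · exact DD_of_notMem s (by simpa using h')

lemma notMem_CC_isOpen : IsOpen {z : Esp n | ∀ j, z ∉ CC j} := by
  have : {z : Esp n | ∀ j, z ∉ CC j} = ⋂ j, (CC j)ᶜ := by ext; simp
  rw [this]
  exact isOpen_iInter_of_finite fun j => (CC_isClosed j).isOpen_compl

lemma DD_contDiff (s : ℝ) : ContDiff ℝ (⊤ : ℕ∞) (DD (n := n) s) := by
  rw [contDiff_iff_contDiffAt]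
  intro z
  by_cases h : ∃ j, z ∈ OO j
  · obtain ⟨j, hj⟩ := h
    refine (GG_contDiffAt hj (s := s)).congr_of_eventuallyEq ?_
    filter_upwards [(OO_isOpen j).mem_nhds hj] with w hw
    exact DD_of_mem s hw
  · push Not at h
    have h2 : z ∈ {z : Esp n | ∀ j, z ∉ CC j} := fun j hj => h j (CC_subset_OO j hj)
    refine contDiffAt_id.congr_of_eventuallyEq ?_
    filter_upwards [notMem_CC_isOpen.mem_nhds h2] with w hw
    exact DD_of_notMem_CC s hw

lemma DD_DD (s : ℝ) (z : Esp n) : DD (-s) (DD s z) = z := by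
  by_cases h : ∃ j, z ∈ OO j
  · obtain ⟨j, hj⟩ := h
    rw [DD_of_mem s hj, DD_of_mem (-s) (GG_mem hj), GG_GG hj]
  · push Not at h
    rw [DD_of_notMem s h, DD_of_notMem _ h]

def DDe : Esp n ≃ₜ Esp n where
  toFun := DD 1
  invFun := DD (-1)
  left_inv z := DD_DD 1 z
  right_inv z := by simpa using DD_DD (-1) z
  continuous_toFun := (DD_contDiff 1).continuous
  continuous_invFun := (DD_contDiff (-1)).continuous

def F0 (z : Esp n) : ℝ := Q (DD 1 z)

lemma F0_contDiff : ContDiff ℝ (⊤ : ℕ∞) (F0 (n := n)) := Q_contDiff.comp (DD_contDiff 1)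

lemma F0_of_mem {j : Fin n} {z : Esp n} (h : z ∈ OO j) :
    F0 z = 1 + KK (MM n) (D2 j z) (yy j z) (vv j z) (hh z) := by
  rw [F0, DD_of_mem 1 h, GG_Q h, h1, one_mul]; rfl
lemma F0_of_notMem {z : Esp n} (h : ∀ j, z ∉ OO j) : F0 z = Q z := by
  rw [F0, DD_of_notMem 1 h]
lemma F0_of_notMem_CC {z : Esp n} (h : ∀ j, z ∉ CC j) : F0 z = Q z := by
  rw [F0, DD_of_notMem_CC 1 h]

lemma F0_ne {z : Esp n} (h : F0 z ≠ Q z) : |Q z - 1| < 1 / 100 ∧ |F0 z - 1| < 1 / 100 := by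
  by_cases h' : ∃ j, z ∈ OO j
  · obtain ⟨j, hj⟩ := h'
    have h1 := hh_small hj.2.2
    have h2 := h1_small hj (s := 1)
    have := mm_le (n := n)
    refine ⟨by unfold hh at h1; linarith, ?_⟩
    rw [F0, DD_of_mem 1 hj, GG_Q hj, add_sub_cancel_left]
    linarith
  · push Not at h'
    exact absurd (F0_of_notMem h') h

end Plug

namespace Plug
set_option linter.unusedSectionVars false
variable [hn3 : Fact (3 ≤ n)]

/-! ### The gradient of `F0` -/

lemma grad_inner (F : Esp n → ℝ) (z e : Esp n) :
    inner ℝ (gradient F z) e = fderiv ℝ F z e := by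
  unfold gradient
  exact InnerProductSpace.toDual_symm_apply

lemma inner_single (g : Esp n) (k : Fin n) (c : ℂ) :
    inner ℝ g (EuclideanSpace.single k c : Esp n) = inner ℝ (g k) c := by
  rw [PiLp.inner_apply, Finset.sum_eq_single k]
  · simp
  · intro l _ hl; simp [hl]
  · simp

lemma grad_comp {F : Esp n → ℝ} {z : Esp n} (hF : DifferentiableAt ℝ F z) {k : Fin n} {c : ℂ} {r : ℝ}
    (h : HasDerivAt (fun t : ℝ => F (z + t • (EuclideanSpace.single k c : Esp n))) r 0) :
    inner ℝ (gradient F z k) c = r := by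
  rw [← inner_single, grad_inner]
  have h1 : HasDerivAt (fun t : ℝ => z + t • (EuclideanSpace.single k c : Esp n))
      (EuclideanSpace.single k c : Esp n) 0 := by
    simpa using ((hasDerivAt_id (0:ℝ)).smul_const (EuclideanSpace.single k c : Esp n)).const_add z
  have h2 : HasFDerivAt F (fderiv ℝ F z) (z + (0:ℝ) • (EuclideanSpace.single k c : Esp n)) := by
    simpa using hF.hasFDerivAt
  exact (h2.comp_hasDerivAt 0 h1).unique h

lemma line_apply (z : Esp n) (k l : Fin n) (c : ℂ) (t : ℝ) :
    (z + t • (EuclideanSpace.single k c : Esp n)) l = if l = k then z l + t * c else z l := by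
  by_cases h : l = k
  · subst h; simp
  · simp [h]

lemma hasDerivAt_norm_sq_line (a c : ℂ) :
    HasDerivAt (fun t : ℝ => ‖a + t * c‖ ^ 2) (2 * inner ℝ a c) 0 := by
  have h1 : HasDerivAt (fun t : ℝ => a + t * c) c 0 := by
    simpa using ((Complex.ofRealCLM.hasDerivAt (x := (0:ℝ))).mul_const c).const_add a
  simpa using h1.norm_sq

lemma Q_line (z : Esp n) (k : Fin n) (c : ℂ) :
    HasDerivAt (fun t : ℝ => Q (z + t • (EuclideanSpace.single k c : Esp n)))
      (om k * inner ℝ (z k) c) 0 := by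
  unfold Q
  have h : ∀ l ∈ (Finset.univ : Finset (Fin n)), HasDerivAt (fun t : ℝ => om l *
      ‖(z + t • (EuclideanSpace.single k c : Esp n)) l‖ ^ 2 / 2)
      (if l = k then om k * inner ℝ (z k) c else 0) 0 := fun l _ => by
    simp only [line_apply]
    split_ifs with h
    · subst h
      refine (((hasDerivAt_norm_sq_line (z l) c).const_mul (om l)).div_const 2).congr_deriv ?_
      ring
    · exact hasDerivAt_const _ _
  simpa using HasDerivAt.fun_sum h

lemma eventually_line {z : Esp n} {U : Set (Esp n)} (hU : IsOpen U) (hz : z ∈ U) (k : Fin n) (c : ℂ) :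
    ∀ᶠ t : ℝ in 𝓝 0, z + t • (EuclideanSpace.single k c : Esp n) ∈ U := by
  have hc : Continuous fun t : ℝ => z + t • (EuclideanSpace.single k c : Esp n) := by fun_prop
  exact hc.continuousAt.eventually_mem (hU.mem_nhds (by simpa using hz))

lemma ext_inner_C {a b : ℂ} (h : ∀ c : ℂ, inner ℝ a c = (inner ℝ b c : ℝ)) : a = b :=
  ext_inner_right ℝ h

/-- the coefficient of the torus rotation -/
def Kd (j k : Fin n) (z : Esp n) : ℝ :=
  om k * Ky (MM n) (D2 j z) (yy j z) (vv j z) (hh z) +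
    (if k = kz j then 0 else 2 * dd j k z) * KD (MM n) (D2 j z) (yy j z) (vv j z) (hh z)
def Kr (j : Fin n) (z : Esp n) : ℝ := Kh (MM n) (D2 j z) (yy j z) (vv j z) (hh z)

lemma F0_differentiableAt (z : Esp n) : DifferentiableAt ℝ F0 z :=
  F0_contDiff.differentiable (by simp) z

lemma grad_F0_out {z : Esp n} (h : ∀ j, z ∉ CC j) (k : Fin n) :
    gradient F0 z k = (om k : ℂ) * z k := by
  refine ext_inner_C fun c => ?_
  rw [grad_comp (F0_differentiableAt z) (r := om k * inner ℝ (z k) c)]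
  · simp [Complex.inner]; ring
  · refine (Q_line z k c).congr_of_eventuallyEq ?_
    filter_upwards [eventually_line notMem_CC_isOpen h k c] with t ht
    exact F0_of_notMem_CC ht

lemma grad_F0_in {j k : Fin n} {z : Esp n} (hz : z ∈ OO j) (hk : k ≠ j) :
    gradient F0 z k = ((Kr j z * om k : ℝ) : ℂ) * z k + (Kd j k z : ℂ) * (z k - EE j k z) := by
  refine ext_inner_C fun c => ?_
  set e : Esp n := EuclideanSpace.single k c with he
  have hth : ∀ t : ℝ, th j (z + t • e) = th j z := fun t => by
    rw [th, line_apply, if_neg hk.symm, th]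
  have hE : ∀ (l : Fin n) (t : ℝ), EE j l (z + t • e) = EE j l z := fun l t => by
    simp only [EE, hth]
  have hla : ∀ (l : Fin n) (t : ℝ), (z + t • e) l = if l = k then z l + t * c else z l :=
    fun l t => line_apply z k l c t
  have hdd : ∀ l : Fin n, HasDerivAt (fun t : ℝ => dd j l (z + t • e))
      (if l = k then inner ℝ (z k - EE j k z) c else 0) 0 := fun l => by
    by_cases hl : l = j
    · subst hl
      simp only [dd, if_true, if_neg hk.symm]
      exact hasDerivAt_const _ _
    · simp only [dd, if_neg hl, hE, hla]
      split_ifs with h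
      · subst h
        have := (((hasDerivAt_norm_sq_line (z l - EE j l z) c).sub_const (pp n ^ 2)).div_const 2)
        refine (this.congr_deriv (by ring)).congr_of_eventuallyEq ?_
        filter_upwards with t
        rw [sub_add_eq_add_sub]
      · exact hasDerivAt_const _ _
  have hy : HasDerivAt (fun t : ℝ => yy j (z + t • e)) (om k * inner ℝ (z k - EE j k z) c) 0 := by
    have := HasDerivAt.fun_sum (u := Finset.univ) fun l _ => (hdd l).const_mul (om l)
    simp only [mul_ite, mul_zero, Finset.sum_ite_eq', Finset.mem_univ, if_true] at this
    exact this
  have hD : HasDerivAt (fun t : ℝ => D2 j (z + t • e))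
      ((if k = kz j then 0 else 2 * dd j k z) * inner ℝ (z k - EE j k z) c) 0 := by
    have h : ∀ l ∈ (Finset.univ : Finset (Fin n)), HasDerivAt
        (fun t : ℝ => if l = kz j then 0 else dd j l (z + t • e) ^ 2)
        (if l = k then (if k = kz j then 0 else 2 * dd j k z) * inner ℝ (z k - EE j k z) c else 0) 0 := by
      intro l _
      by_cases h : l = kz j
      · simp only [if_pos h]
        refine (hasDerivAt_const _ _).congr_deriv ?_
        split_ifs with h1 h2 <;> simp_all
      · simp only [if_neg h]
        refine ((hdd l).pow 2).congr_deriv ?_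
        split_ifs with h1 h2
        · simp_all
        · subst h1; simp
        · simp
    have := HasDerivAt.fun_sum h
    simp only [Finset.sum_ite_eq', Finset.mem_univ, if_true] at this
    exact this
  have hh' : HasDerivAt (fun t : ℝ => hh (z + t • e)) (om k * inner ℝ (z k) c) 0 :=
    (Q_line z k c).sub_const 1
  have key := KK_hasDerivAt (M := MM n) (v := vv j z) hD hy hh'
  simp only [zero_smul, add_zero] at key
  rw [grad_comp (F0_differentiableAt z) (k := k) (c := c) (r := _)
    ((key.const_add 1).congr_of_eventuallyEq ?_)]
  · simp only [Kd, Kr, inner_add_left, Complex.inner]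
    simp only [Complex.mul_re, Complex.mul_im, map_mul, map_sub, Complex.conj_ofReal, Complex.ofReal_re,
      Complex.ofReal_im, Complex.conj_re, Complex.conj_im, Complex.sub_re, Complex.sub_im]
    ring
  · filter_upwards [eventually_line (OO_isOpen j) hz k c] with t ht
    rw [F0_of_mem ht]
    simp only [vv, hth, ← he]

lemma grad_F0_j {j : Fin n} {z : Esp n} (hz : z ∈ OO j) :
    inner ℝ (gradient F0 z j) (z j) = Kr j z * (om j * ‖z j‖ ^ 2) := by
  set e : Esp n := EuclideanSpace.single j (z j) with he
  have ev : ∀ᶠ t : ℝ in 𝓝 0, 0 < 1 + t := by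
    have : Continuous fun t : ℝ => 1 + t := by fun_prop
    exact this.continuousAt.eventually_mem (Ioi_mem_nhds (by norm_num))
  have hth : ∀ t : ℝ, 0 < 1 + t → th j (z + t • e) = th j z := fun t ht => by
    rw [th, line_apply, if_pos rfl, show z j + t * z j = ((1 + t : ℝ) : ℂ) * z j by push_cast; ring,
      Complex.arg_real_mul _ ht, th]
  have hdd : ∀ t : ℝ, 0 < 1 + t → ∀ l : Fin n, dd j l (z + t • e) = dd j l z := fun t ht l => by
    unfold dd
    split_ifs with h
    · rfl
    · simp only [EE, hth t ht]
      rw [he, line_apply, if_neg h]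
  have hh' : HasDerivAt (fun t : ℝ => hh (z + t • e)) (om j * inner ℝ (z j) (z j)) 0 :=
    (Q_line z j (z j)).sub_const 1
  have key := KK_hasDerivAt (M := MM n) (v := vv j z) (hasDerivAt_const 0 (D2 j z))
    (hasDerivAt_const 0 (yy j z)) hh'
  simp only [zero_smul, add_zero, mul_zero] at key
  rw [grad_comp (F0_differentiableAt z) (k := j) (c := z j) (r := _)
    ((key.const_add 1).congr_of_eventuallyEq ?_)]
  · rw [real_inner_self_eq_norm_sq, Kr]
  · filter_upwards [eventually_line (OO_isOpen j) hz j (z j), ev] with t ht h1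
    rw [F0_of_mem ht]
    simp only [D2, yy, hdd t h1, vv, hth t h1, ← he]

/-! ### Local analysis of orbits -/

structure Orb (κ : ℝ) (ζ : ℝ → Esp n) : Prop where
  pos : 0 < κ
  der : ∀ t, HasDerivAt ζ (κ • (Complex.I • gradient F0 (ζ t))) t
  lev : ∀ t, F0 (ζ t) = 1

/-- rotating coordinates -/
def ww (j k : Fin n) (z : Esp n) : ℂ :=
  z k * Complex.exp (((-(om k / om j * th j z) : ℝ) : ℂ) * Complex.I)

lemma ww_eq (j k : Fin n) (z : Esp n) :
    Complex.exp (((om k / om j * th j z : ℝ) : ℂ) * Complex.I) * ww j k z = z k := by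
  rw [ww, mul_left_comm, ← Complex.exp_add]
  simp

lemma EE_sub (j k : Fin n) (z : Esp n) : z k - EE j k z =
    Complex.exp (((om k / om j * th j z : ℝ) : ℂ) * Complex.I) * (ww j k z - pp n) := by
  rw [mul_sub, ww_eq, EE]; ring

lemma norm_ww (j k : Fin n) (z : Esp n) : ‖ww j k z - pp n‖ = ‖z k - EE j k z‖ := by
  rw [EE_sub, norm_mul, Complex.norm_exp_ofReal_mul_I, one_mul]

lemma dd_ww {j k : Fin n} (hk : k ≠ j) (z : Esp n) :
    dd j k z = (‖ww j k z - pp n‖ ^ 2 - pp n ^ 2) / 2 := by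
  rw [norm_ww, dd, if_neg hk]

section orb
variable {κ : ℝ} {ζ : ℝ → Esp n}

lemma Orb.continuous (ho : Orb κ ζ) : Continuous ζ :=
  continuous_iff_continuousAt.2 fun t => (ho.der t).continuousAt

lemma Orb.comp (ho : Orb κ ζ) (k : Fin n) (t : ℝ) :
    HasDerivAt (fun t => ζ t k) (κ * (Complex.I * gradient F0 (ζ t) k)) t := by
  have h := (PiLp.proj 2 (𝕜 := ℝ) (fun _ : Fin n => ℂ) k : Esp n →L[ℝ] ℂ).hasFDerivAt.comp_hasDerivAt t (ho.der t)
  refine h.congr_deriv ?_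
  simp

lemma Orb.KK_zero (ho : Orb κ ζ) {j : Fin n} {t : ℝ} (h : ζ t ∈ OO j) :
    KK (MM n) (D2 j (ζ t)) (yy j (ζ t)) (vv j (ζ t)) (hh (ζ t)) = 0 := by
  have := F0_of_mem h
  rw [ho.lev] at this
  linarith

lemma Orb.hh_eta (ho : Orb κ ζ) {j : Fin n} {t : ℝ} (h : ζ t ∈ OO j) :
    hh (ζ t) = eta (MM n) (D2 j (ζ t)) (yy j (ζ t)) (vv j (ζ t)) :=
  eta_eq MM_pos (D2_nonneg j _) (ho.KK_zero h)

lemma Orb.th_der (ho : Orb κ ζ) {j : Fin n} {t : ℝ} (h : ζ t ∈ OO j) :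
    HasDerivAt (fun t => th j (ζ t)) (κ * (om j * Kr j (ζ t))) t := by
  have h1 := (ho.comp j t).clog_real (Or.inl h.1)
  have h2 := Complex.imCLM.hasFDerivAt.comp_hasDerivAt t h1
  have h3 : ∀ s, th j (ζ s) = (Complex.imCLM ∘ fun t => Complex.log (ζ t j)) s := fun s => by
    simp [th, Complex.log_im]
  refine (h2.congr_of_eventuallyEq (Filter.Eventually.of_forall h3)).congr_deriv ?_
  have h4 := grad_F0_j h
  have h5 : ζ t j ≠ 0 := zj_ne h.1
  set g := gradient F0 (ζ t) j
  set w := ζ t j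
  have h6 : ‖w‖ ^ 2 ≠ 0 := by positivity
  rw [Complex.inner] at h4
  have h7 : Complex.normSq w = ‖w‖ ^ 2 := Complex.normSq_eq_norm_sq w
  simp only [Complex.imCLM_apply]
  rw [div_eq_mul_inv, Complex.inv_def, h7, ← mul_assoc, mul_comm _ (((‖w‖ ^ 2)⁻¹ : ℝ) : ℂ),
    Complex.im_ofReal_mul]
  have h8 : ((κ : ℂ) * (Complex.I * g) * (starRingEnd ℂ) w).im = κ * (w * (starRingEnd ℂ) g).re := by
    simp; ring
  rw [h8, h4]
  field_simp

lemma Orb.ww_der (ho : Orb κ ζ) {j k : Fin n} {t : ℝ} (h : ζ t ∈ OO j) (hk : k ≠ j) :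
    HasDerivAt (fun t => ww j k (ζ t))
      (Complex.I * ((κ * Kd j k (ζ t) : ℝ) : ℂ) * (ww j k (ζ t) - pp n)) t := by
  have h1 := ho.comp k t
  have h2 : HasDerivAt (fun t => ((-(om k / om j * th j (ζ t)) : ℝ) : ℂ))
      ((-(om k / om j * (κ * (om j * Kr j (ζ t)))) : ℝ) : ℂ) t :=
    (((ho.th_der h).const_mul (om k / om j)).neg).ofReal_comp
  have h3 := h1.mul ((h2.mul_const Complex.I).cexp)
  refine h3.congr_deriv ?_
  rw [grad_F0_in h hk, EE_sub]
  have h4 : om k / om j * (κ * (om j * Kr j (ζ t))) = om k * κ * Kr j (ζ t) := by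
    have := (om_pos j).ne'
    field_simp
  rw [h4]
  have h5 : Complex.exp (((om k / om j * th j (ζ t) : ℝ) : ℂ) * Complex.I) *
    Complex.exp (((-(om k / om j * th j (ζ t)) : ℝ) : ℂ) * Complex.I) = 1 := by
    rw [← Complex.exp_add]; simp
  simp only [ww]
  set A := Complex.exp (((om k / om j * th j (ζ t) : ℝ) : ℂ) * Complex.I)
  set B := Complex.exp (((-(om k / om j * th j (ζ t)) : ℝ) : ℂ) * Complex.I)
  push_cast
  linear_combination (κ * Complex.I * Kd j k (ζ t) * (ζ t k * B - pp n)) * h5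

lemma Orb.dd_der (ho : Orb κ ζ) {j : Fin n} (k : Fin n) {t : ℝ} (h : ζ t ∈ OO j) :
    HasDerivAt (fun t => dd j k (ζ t)) 0 t := by
  by_cases hk : k = j
  · simp only [dd, if_pos hk]; exact hasDerivAt_const _ _
  · simp only [dd_ww hk]
    have := ((((ho.ww_der h hk).sub_const (pp n : ℂ)).norm_sq.sub_const (pp n ^ 2)).div_const 2)
    refine this.congr_deriv ?_
    rw [Complex.inner]
    simp
    ring

lemma Orb.eventually (ho : Orb κ ζ) {j : Fin n} {t : ℝ} (h : ζ t ∈ OO j) :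
    ∀ᶠ s in 𝓝 t, ζ s ∈ OO j := ho.continuous.continuousAt.eventually_mem ((OO_isOpen j).mem_nhds h)

/-- functions with vanishing derivative in the box are locally constant -/
lemma Orb.loc_const (ho : Orb κ ζ) {E : Type*} [NormedAddCommGroup E] [NormedSpace ℝ E] {j : Fin n} {t : ℝ}
    (h : ζ t ∈ OO j) {f : ℝ → E}
    (hf : ∀ s, ζ s ∈ OO j → HasDerivAt f 0 s) : ∀ᶠ s in 𝓝 t, f s = f t := by
  obtain ⟨ε, hε, hb⟩ := Metric.eventually_nhds_iff_ball.1 (ho.eventually h)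
  filter_upwards [Metric.ball_mem_nhds t hε] with s hs
  exact (convex_ball t ε).is_const_of_fderivWithin_eq_zero (𝕜 := ℝ)
    (fun x hx => ((hf x (hb x hx)).differentiableAt).differentiableWithinAt)
    (fun x hx => by
      rw [fderivWithin_of_isOpen Metric.isOpen_ball hx]
      ext; simp [(hf x (hb x hx)).deriv]) hs (Metric.mem_ball_self hε)

lemma Orb.dd_const (ho : Orb κ ζ) {j : Fin n} {t : ℝ} (h : ζ t ∈ OO j) :
    ∀ᶠ s in 𝓝 t, ζ s ∈ OO j ∧ (∀ k, dd j k (ζ s) = dd j k (ζ t)) ∧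
      D2 j (ζ s) = D2 j (ζ t) ∧ yy j (ζ s) = yy j (ζ t) := by
  have : ∀ᶠ s in 𝓝 t, ∀ k, dd j k (ζ s) = dd j k (ζ t) :=
    Filter.eventually_all.2 fun k => ho.loc_const h fun s hs => ho.dd_der k hs
  filter_upwards [this, ho.eventually h] with s hs h2
  refine ⟨h2, hs, ?_, ?_⟩
  · simp only [D2, hs]
  · simp only [yy, hs]

lemma Orb.vv_der (ho : Orb κ ζ) {j : Fin n} {t : ℝ} (h : ζ t ∈ OO j) :
    HasDerivAt (fun t => vv j (ζ t)) (2 * (κ * (om j * Kr j (ζ t)))) t :=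
  (ho.th_der h).const_mul 2

end orb

end Plug

namespace Plug
set_option linter.unusedSectionVars false

lemma ode_exp {f : ℝ → ℂ} {L l : ℝ → ℝ} {c : ℝ} (hL : ∀ t, HasDerivAt L (l t) t)
    (hf : ∀ t, HasDerivAt f (Complex.I * ((c * l t : ℝ) : ℂ) * f t) t) (t : ℝ) :
    f t = f 0 * Complex.exp (((c * (L t - L 0) : ℝ) : ℂ) * Complex.I) := by
  have h1 : ∀ t, HasDerivAt (fun t => f t * Complex.exp (((-(c * (L t - L 0)) : ℝ) : ℂ) * Complex.I)) 0 t := by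
    intro t
    have h2 : HasDerivAt (fun t => ((-(c * (L t - L 0)) : ℝ) : ℂ)) ((-(c * l t) : ℝ) : ℂ) t :=
      ((((hL t).sub_const (L 0)).const_mul c).neg).ofReal_comp
    refine ((hf t).mul ((h2.mul_const Complex.I).cexp)).congr_deriv ?_
    push_cast; ring
  have h3 := is_const_of_deriv_eq_zero (fun t => (h1 t).differentiableAt) (fun t => (h1 t).deriv) t 0
  simp only [sub_self, mul_zero, neg_zero, Complex.ofReal_zero, zero_mul, Complex.exp_zero, mul_one] at h3
  rw [← h3, mul_assoc, ← Complex.exp_add]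
  simp

lemma exp_one_int {a : ℝ} (h : Complex.exp ((a : ℂ) * Complex.I) = 1) :
    ∃ N : ℤ, a = 2 * Real.pi * N := by
  obtain ⟨N, hN⟩ := Complex.exp_eq_one_iff.1 h
  refine ⟨N, ?_⟩
  have : (a : ℂ) = ((2 * Real.pi * N : ℝ) : ℂ) := by
    apply mul_right_cancel₀ Complex.I_ne_zero
    rw [hN]; push_cast; ring
  exact_mod_cast this

lemma irr {k l : Fin n} {a : ℝ} (ha : a ≠ 0)
    (hk : Complex.exp (((om k * a : ℝ) : ℂ) * Complex.I) = 1)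
    (hl : Complex.exp (((om l * a : ℝ) : ℂ) * Complex.I) = 1) : k = l := by
  obtain ⟨N, hN⟩ := exp_one_int hk
  obtain ⟨N', hN'⟩ := exp_one_int hl
  have hpi := Real.pi_pos
  have e : om k * N' = om l * N := by
    apply mul_left_cancel₀ (mul_ne_zero ha (show 2 * Real.pi ≠ 0 by positivity))
    linear_combination (2 * Real.pi * N') * hN - (2 * Real.pi * N) * hN'
  have hN0 : N ≠ 0 := by
    rintro rfl
    have : om k * a = 0 := by simpa using hN
    rcases mul_eq_zero.1 this with h | h
    · exact (om_pos k).ne' h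
    · exact ha h
  unfold om at e
  have e2 : (((k : ℕ) : ℤ) * N' - ((l : ℕ) : ℤ) * N : ℤ) * √2 = ((N - N' : ℤ) : ℝ) := by
    push_cast; linarith
  have hz : (((k : ℕ) : ℤ) * N' - ((l : ℕ) : ℤ) * N : ℤ) = 0 := by
    by_contra hne
    have := irrational_sqrt_two.intCast_mul hne
    rw [e2] at this
    exact (this.ne_int _) rfl
  have hz2 : N - N' = 0 := by
    rw [hz] at e2
    have : ((N - N' : ℤ) : ℝ) = 0 := by rw [← e2]; simp
    exact_mod_cast this
  have : N' = N := by omega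
  rw [this, ← sub_mul] at hz
  rcases mul_eq_zero.1 hz with h | h
  · apply Fin.ext; omega
  · exact absurd h hN0

variable [hn3 : Fact (3 ≤ n)]

def core (j : Fin n) (z : Esp n) : Prop := z ∈ OO j ∧ vv j z ^ 2 = 1 ∧ D2 j z = 0 ∧ yy j z = 0

lemma dd_zero {j : Fin n} {z : Esp n} (hD : D2 j z = 0) (hy : yy j z = 0) (k : Fin n) :
    dd j k z = 0 := by
  have h1 : ∀ k, k ≠ kz j → dd j k z = 0 := fun k hk => by
    have := (Finset.sum_eq_zero_iff_of_nonneg (fun i _ => by split_ifs <;> positivity)).1 hD k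
      (Finset.mem_univ k)
    simpa [hk] using this
  by_cases hk : k = kz j
  · have e : yy j z = om k * dd j k z :=
      Finset.sum_eq_single k (fun l _ hl => by rw [h1 l (hk ▸ hl), mul_zero]) (by simp)
    rw [hy] at e
    rcases mul_eq_zero.1 e.symm with h | h
    · exact absurd h (om_pos k).ne'
    · exact h
  · exact h1 k hk

lemma q_one {v : ℝ} (h : v ^ 2 = 1) : (q v) ^ 2 = 1 := by
  unfold q
  have : (3 * v - v ^ 3) / 2 = v := by
    have : v ^ 3 = v := by rw [pow_succ, h, one_mul]
    rw [this]; ring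
  rw [this, h]

lemma cos_core {v : ℝ} (h : v ^ 2 = 1) : Real.cos (al v 0) = 0 := by
  have h1 : q v = 1 ∨ q v = -1 := by
    have h0 := q_one h
    exact sq_eq_sq_iff_eq_or_eq_neg.1 (by rw [h0]; norm_num)
  have h2 : rho ((v ^ 2 - 1) ^ 2 + 0) = 1 := by rw [h]; simp [rho_zero]
  rw [al, h2]
  rcases h1 with h | h <;> simp [h]

lemma Kh_core (M v : ℝ) : Kh M 0 0 v 0 = Real.cos (al v 0) := by simp [Kh, NN]
lemma Ky_core (M v : ℝ) : Ky M 0 0 v 0 = Real.sin (al v 0) := by simp [Ky, NN]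
lemma KK_core (M v : ℝ) : KK M 0 0 v 0 = 0 := by simp [KK]

section orb
variable {κ : ℝ} {ζ : ℝ → Esp n}

lemma Orb.hh_core (ho : Orb κ ζ) {j : Fin n} {t : ℝ} (h : ζ t ∈ OO j) (hD : D2 j (ζ t) = 0) (hy : yy j (ζ t) = 0) :
    hh (ζ t) = 0 := by
  have := ho.KK_zero h
  rw [hD, hy] at this
  exact KK_zero_unique MM_pos le_rfl this (KK_core _ _)

lemma Orb.core_open (ho : Orb κ ζ) {j : Fin n} {t : ℝ} (h : core j (ζ t)) : ∀ᶠ s in 𝓝 t, core j (ζ s) := by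
  obtain ⟨hO, hv, hD, hy⟩ := h
  have hev := ho.dd_const hO
  rw [hD, hy] at hev
  have hC1 : ContDiff ℝ 1 (fun v : ℝ => 2 * (κ * (om j * Real.cos (al v 0)))) := by
    have : ContDiff ℝ 1 rho := rho_contDiff.of_le (by simp)
    unfold al q
    fun_prop
  obtain ⟨K, S, hS, hLip⟩ := (hC1.contDiffAt (x := vv j (ζ t))).exists_lipschitzOnWith
  have hcv : ContinuousAt (fun s => vv j (ζ s)) t := (ho.vv_der hO).continuousAt
  have key := ODE_solution_unique_of_eventually (t₀ := t)
    (v := fun _ v => 2 * (κ * (om j * Real.cos (al v 0)))) (s := fun _ => S) (K := K)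
    (f := fun s => vv j (ζ s)) (g := fun _ => vv j (ζ t))
    (Filter.Eventually.of_forall fun _ => hLip) ?_ ?_ rfl
  · filter_upwards [hev, key] with s ⟨h1, h2, h3, h4⟩ h5
    refine ⟨h1, ?_, h3, h4⟩
    rw [h5, hv]
  · filter_upwards [hev, hcv.eventually_mem hS] with s ⟨h1, h2, h3, h4⟩ h5
    refine ⟨?_, h5⟩
    have := ho.vv_der h1
    rw [Kr, h3, h4, ho.hh_core h1 h3 h4, Kh_core] at this
    exact this
  · filter_upwards with s
    refine ⟨?_, mem_of_mem_nhds hS⟩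
    simp only [cos_core hv, mul_zero]
    exact hasDerivAt_const _ _

lemma Orb.core_CC (ho : Orb κ ζ) {j : Fin n} {t : ℝ} (h : core j (ζ t)) : ζ t ∈ CC j := by
  obtain ⟨hO, hv, hD, hy⟩ := h
  refine ⟨hO.1, by linarith, ?_⟩
  rw [rr, hD, hy, ho.hh_core hO hD hy]; simp

lemma Orb.core_all (ho : Orb κ ζ) {j : Fin n} {t : ℝ} (h : core j (ζ t)) (s : ℝ) : core j (ζ s) := by
  have hcl : IsClopen {s | core j (ζ s)} := by
    constructor
    · rw [← isOpen_compl_iff, isOpen_iff_eventually]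
      intro s hs
      by_cases hC : ζ s ∈ CC j
      · have hO := CC_subset_OO j hC
        have c := ho.continuous.continuousAt (x := s)
        have c1 : ContinuousAt (fun s => vv j (ζ s) ^ 2) s :=
          (((vv_contDiffAt hO.1).pow 2).continuousAt).comp' c
        have c2 : ContinuousAt (fun s => D2 j (ζ s)) s := ((D2_contDiffAt hO.1).continuousAt).comp' c
        have c3 : ContinuousAt (fun s => yy j (ζ s)) s := ((yy_contDiffAt hO.1).continuousAt).comp' c
        by_cases e1 : vv j (ζ s) ^ 2 = 1
        · by_cases e2 : D2 j (ζ s) = 0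
          · have e3 : yy j (ζ s) ≠ 0 := fun e3 => hs ⟨hO, e1, e2, e3⟩
            filter_upwards [c3.eventually_ne e3] with x hx hc using hx hc.2.2.2
          · filter_upwards [c2.eventually_ne e2] with x hx hc using hx hc.2.2.1
        · filter_upwards [c1.eventually_ne e1] with x hx hc using hx hc.2.1
      · have := ho.continuous.continuousAt.eventually_mem ((CC_isClosed j).isOpen_compl.mem_nhds hC)
        filter_upwards [this] with x hx hc using hx (ho.core_CC hc)
    · rw [isOpen_iff_eventually]
      exact fun s hs => ho.core_open hs
  have := hcl.eq_univ ⟨t, h⟩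
  have h2 : s ∈ {s | core j (ζ s)} := by rw [this]; trivial
  exact h2

lemma Orb.no_core (ho : Orb κ ζ) {T : ℝ} (hT : 0 < T) (hper : ∀ t, ζ (t + T) = ζ t) (j : Fin n) (t : ℝ) :
    ¬ core j (ζ t) := by
  intro h
  have hall := ho.core_all h
  have hvc : ∀ s, vv j (ζ s) = vv j (ζ 0) := fun s => by
    refine is_const_of_deriv_eq_zero (f := fun s => vv j (ζ s)) (fun s => (ho.vv_der (hall s).1).differentiableAt) (fun s => ?_) s 0
    obtain ⟨hO, hv, hD, hy⟩ := hall s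
    rw [(ho.vv_der hO).deriv, Kr, hD, hy, ho.hh_core hO hD hy, Kh_core, cos_core hv]
    simp
  set σ := Real.sin (al (vv j (ζ 0)) 0) with hσ
  have hσ0 : σ ≠ 0 := by
    intro h0
    have := Real.sin_sq_add_cos_sq (al (vv j (ζ 0)) 0)
    rw [← hσ, h0, cos_core (hall 0).2.1] at this
    norm_num at this
  have key : ∀ k, k ≠ j → Complex.exp (((om k * (κ * σ * T) : ℝ) : ℂ) * Complex.I) = 1 := by
    intro k hk
    have hder : ∀ t, HasDerivAt (fun t => ww j k (ζ t) - pp n)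
        (Complex.I * ((om k * (κ * σ) : ℝ) : ℂ) * (ww j k (ζ t) - pp n)) t := fun t => by
      obtain ⟨hO, hv, hD, hy⟩ := hall t
      have h1 := (ho.ww_der hO hk).sub_const (pp n : ℂ)
      rw [Kd, dd_zero hD hy, hD, hy, ho.hh_core hO hD hy, Ky_core, hvc t, ← hσ] at h1
      refine h1.congr_deriv ?_
      simp only [mul_zero, ite_self, zero_mul, add_zero]
      push_cast; ring
    have hL : ∀ t : ℝ, HasDerivAt (fun t => κ * σ * t) (κ * σ) t := fun t => by
      simpa using (hasDerivAt_id t).const_mul (κ * σ)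
    have h2 := ode_exp (f := fun t => ww j k (ζ t) - pp n) (c := om k) hL hder T
    have h3 : ζ T = ζ 0 := by simpa using hper 0
    simp only [h3, mul_zero, sub_zero] at h2
    have h4 : ww j k (ζ 0) - pp n ≠ 0 := by
      intro h0
      have := dd_ww hk (ζ 0)
      rw [dd_zero (hall 0).2.2.1 (hall 0).2.2.2, h0] at this
      have h5 := pow_pos (pp_pos (n := n)) 2
      rw [norm_zero] at this
      linarith
    exact (mul_eq_left₀ h4).1 h2.symm
  have hne : κ * σ * T ≠ 0 := mul_ne_zero (mul_ne_zero ho.pos.ne' hσ0) hT.ne'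
  have hcard : 2 ≤ (Finset.univ.erase j).card := by
    rw [Finset.card_erase_of_mem (Finset.mem_univ j), Finset.card_univ, Fintype.card_fin]
    have := hn3.out; omega
  obtain ⟨a, ha, b, hb, hab⟩ := Finset.one_lt_card.1 hcard
  exact hab (irr hne (key a (Finset.ne_of_mem_erase ha)) (key b (Finset.ne_of_mem_erase hb)))

end orb

end Plug

namespace Plug
set_option linter.unusedSectionVars false

/-! ### Straightening coordinates away from the core -/

def Phi (j k : Fin n) (z : Esp n) : ℝ :=
  (om k * Ay (MM n) (D2 j z) (yy j z) (vv j z) +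
    (if k = kz j then 0 else 2 * dd j k z) * AD (MM n) (D2 j z) (yy j z) (vv j z)) / (2 * om j)
def XX (j k : Fin n) (z : Esp n) : ℂ :=
  pp n + (ww j k z - pp n) * Complex.exp (((-(Phi j k z) : ℝ) : ℂ) * Complex.I)
/-- remaining amplitude -/
def RR (j : Fin n) (z : Esp n) : ℝ :=
  √(2 * (1 - ∑ k ∈ Finset.univ.erase j, om k * ‖XX j k z‖ ^ 2 / 2) / om j)
def Amp (j k : Fin n) (z : Esp n) : ℂ := if k = j then (RR j z : ℂ) else XX j k z
def UO (j k : Fin n) (z : Esp n) : ℂ :=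
  Complex.exp (((om k / om j * th j z : ℝ) : ℂ) * Complex.I) * Amp j k z

variable [hn3 : Fact (3 ≤ n)]

open Classical in
def uu (k : Fin n) (z : Esp n) : ℂ := if h : ∃ j, z ∈ OO j then UO h.choose k z else z k
open Classical in
def lam (z : Esp n) : ℝ := if h : ∃ j, z ∈ OO j then Kr h.choose z else 1

lemma uu_of_mem {j : Fin n} {z : Esp n} (h : z ∈ OO j) (k : Fin n) : uu k z = UO j k z := by
  have h' : ∃ j, z ∈ OO j := ⟨j, h⟩
  rw [uu, dif_pos h', OO_disjoint h'.choose_spec h]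
lemma lam_of_mem {j : Fin n} {z : Esp n} (h : z ∈ OO j) : lam z = Kr j z := by
  have h' : ∃ j, z ∈ OO j := ⟨j, h⟩
  rw [lam, dif_pos h', OO_disjoint h'.choose_spec h]
lemma uu_of_notMem {z : Esp n} (h : ∀ j, z ∉ OO j) (k : Fin n) : uu k z = z k := by
  rw [uu, dif_neg (by push Not; exact h)]
lemma lam_of_notMem {z : Esp n} (h : ∀ j, z ∉ OO j) : lam z = 1 := by
  rw [lam, dif_neg (by push Not; exact h)]

lemma norm_XX_sub (j k : Fin n) (z : Esp n) : ‖XX j k z - pp n‖ = ‖z k - EE j k z‖ := by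
  rw [XX, add_sub_cancel_left, norm_mul, Complex.norm_exp_ofReal_mul_I, mul_one, norm_ww]

lemma XX_small {j k : Fin n} {z : Esp n} (h : rr j z < 2) (hk : k ≠ j) :
    ‖XX j k z‖ ^ 2 ≤ 5 * pp n ^ 2 := by
  have h0 : ‖(pp n : ℂ)‖ = pp n := by rw [Complex.norm_real, Real.norm_of_nonneg pp_pos.le]
  refine norm_of_near h0 ?_
  rw [norm_XX_sub, norm_sq_dd hk]
  have := abs_le.1 (dd_small h k)
  linarith

lemma RR_pos {j : Fin n} {z : Esp n} (h : rr j z < 2) : 0 < RR j z := by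
  apply Real.sqrt_pos.2
  have h1 : ∑ k ∈ Finset.univ.erase j, om k * ‖XX j k z‖ ^ 2 / 2 ≤
      ∑ k ∈ Finset.univ.erase j, om k * (5 * pp n ^ 2 / 2) :=
    Finset.sum_le_sum fun k hk => by
      have := XX_small h (Finset.ne_of_mem_erase hk)
      have := om_pos k
      nlinarith
  have h2 : ∑ k ∈ Finset.univ.erase j, om k * (5 * pp n ^ 2 / 2) ≤
      ∑ k : Fin n, om k * (5 * pp n ^ 2 / 2) :=
    Finset.sum_le_sum_of_subset_of_nonneg (Finset.erase_subset _ _) fun k _ _ => by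
      have := om_pos k; positivity
  have h6 : ∑ k : Fin n, om k * (5 * pp n ^ 2 / 2) = W n * (5 * pp n ^ 2 / 2) := by
    rw [W, Finset.sum_mul]
  have h3 := W_pp (n := n); have h4 := pp_le (n := n)
  have h5 : W n * (5 * pp n ^ 2 / 2) = pp n / 2 := by
    linear_combination (5 * pp n / 2) * h3
  have := om_pos j
  apply div_pos _ this
  linarith

lemma uu_ne {j : Fin n} {z : Esp n} (h : z ∈ OO j) : uu j z ≠ 0 := by
  rw [uu_of_mem h, UO, Amp, if_pos rfl]
  exact mul_ne_zero (Complex.exp_ne_zero _) (Complex.ofReal_ne_zero.2 (RR_pos h.2.2).ne')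

section orb
variable {κ : ℝ} {ζ : ℝ → Esp n}

lemma Orb.lam_pos (ho : Orb κ ζ) (hc : ∀ j t, ¬ core j (ζ t)) (t : ℝ) : 0 < lam (ζ t) := by
  by_cases h : ∃ j, ζ t ∈ OO j
  · obtain ⟨j, hj⟩ := h
    rw [lam_of_mem hj]
    exact Kh_pos MM_pos (D2_nonneg j _) (ho.KK_zero hj) fun h => hc j t ⟨hj, h⟩
  · push Not at h
    rw [lam_of_notMem h]; norm_num

/-- outside of the closed boxes the straightening is the identity -/
lemma Orb.out (ho : Orb κ ζ) {t : ℝ} (h : ∀ j, ζ t ∉ CC j) : lam (ζ t) = 1 ∧ ∀ k, uu k (ζ t) = ζ t k := by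
  by_cases h' : ∃ j, ζ t ∈ OO j
  · obtain ⟨j, hj⟩ := h'
    have hQ : Q (ζ t) = 1 := by rw [← F0_of_notMem_CC h, ho.lev]
    have hh0 : hh (ζ t) = 0 := by rw [hh, hQ, sub_self]
    have hcase : 2 ≤ vv j (ζ t) ^ 2 ∨ 1 ≤ MM n * (D2 j (ζ t) + yy j (ζ t) ^ 2) := by
      by_contra hcon
      push Not at hcon
      refine h j ⟨hj.1, hcon.1.le, ?_⟩
      rw [rr, hh0]
      have := hcon.2.le
      simpa using this
    have hbig : 1 ≤ (vv j (ζ t) ^ 2 - 1) ^ 2 + MM n * (D2 j (ζ t) + yy j (ζ t) ^ 2 + 0 ^ 2) := by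
      have := mul_nonneg (MM_pos (n := n)).le (add_nonneg (D2_nonneg j (ζ t)) (sq_nonneg (yy j (ζ t))))
      rcases hcase with h | h
      · nlinarith
      · nlinarith [sq_nonneg (vv j (ζ t) ^ 2 - 1)]
    have hX : ∀ k, XX j k (ζ t) = ww j k (ζ t) := fun k => by
      obtain ⟨e1, e2⟩ := Ay_zero MM_pos (D2_nonneg j _) hcase
      rw [XX, Phi, e1, e2]; simp
    refine ⟨?_, fun k => ?_⟩
    · rw [lam_of_mem hj, Kr, hh0, Kh, al_zero_of_le hbig, alr_zero_of_le hbig]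
      simp
    · rw [uu_of_mem hj, UO, Amp]
      split_ifs with hk
      · subst hk
        have hn : ∀ l, ‖XX k l (ζ t)‖ = ‖ζ t l‖ := fun l => by
          rw [hX, ww, norm_mul, Complex.norm_exp_ofReal_mul_I, mul_one]
        have e := Q_eq k (ζ t)
        have hR : RR k (ζ t) = ‖ζ t k‖ := by
          rw [RR]
          simp only [hn]
          rw [← Real.sqrt_sq (norm_nonneg (ζ t k))]
          congr 1
          have := om_pos k
          field_simp
          rw [hQ] at e
          field_simp at e
          linarith
        rw [hR, div_self (om_pos k).ne', one_mul, mul_comm, th]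
        exact Complex.norm_mul_exp_arg_mul_I _
      · rw [hX, ww_eq]
  · push Not at h'
    exact ⟨lam_of_notMem h', uu_of_notMem h'⟩

lemma Orb.eventually_out (ho : Orb κ ζ) {t : ℝ} (h : ∀ j, ζ t ∉ CC j) : ∀ᶠ s in 𝓝 t, ∀ j, ζ s ∉ CC j :=
  ho.continuous.continuousAt.eventually_mem (notMem_CC_isOpen.mem_nhds h)

lemma Orb.lam_continuous (ho : Orb κ ζ) : Continuous fun t => lam (ζ t) := by
  rw [continuous_iff_continuousAt]
  intro t
  by_cases h : ∃ j, ζ t ∈ OO j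
  · obtain ⟨j, hj⟩ := h
    have e : (fun t => lam (ζ t)) =ᶠ[𝓝 t] fun s => Kr j (ζ s) := by
      filter_upwards [ho.eventually hj] with s hs using lam_of_mem hs
    refine ContinuousAt.congr ?_ e.symm
    have c := ho.continuous.continuousAt (x := t)
    have c1 : ContinuousAt (fun s => vv j (ζ s)) t := ((vv_contDiffAt hj.1).continuousAt).comp' c
    have c2 : ContinuousAt (fun s => D2 j (ζ s)) t := ((D2_contDiffAt hj.1).continuousAt).comp' c
    have c3 : ContinuousAt (fun s => yy j (ζ s)) t := ((yy_contDiffAt hj.1).continuousAt).comp' c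
    have c4 : ContinuousAt (fun s => hh (ζ s)) t := (hh_contDiff.continuous.continuousAt).comp' c
    have hK : Continuous fun x : ℝ × ℝ × ℝ × ℝ => Kh (MM n) x.1 x.2.1 x.2.2.1 x.2.2.2 := by
      have := rho_continuous; have := rho_deriv_continuous
      unfold Kh NN alr al q; fun_prop
    exact (hK.continuousAt (x := (D2 j (ζ t), yy j (ζ t), vv j (ζ t), hh (ζ t)))).comp'
      (f := fun s => (D2 j (ζ s), yy j (ζ s), vv j (ζ s), hh (ζ s)))
      (c2.prodMk (c3.prodMk (c1.prodMk c4)))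
  · have h' : ∀ j, ζ t ∉ CC j := fun j hj => h ⟨j, CC_subset_OO j hj⟩
    refine (continuousAt_const (y := (1:ℝ))).congr ?_
    filter_upwards [ho.eventually_out h'] with s hs using (ho.out hs).1.symm

lemma Orb.XX_der (ho : Orb κ ζ) {j k : Fin n} {t : ℝ} (h : ζ t ∈ OO j) (hc : ¬ core j (ζ t)) (hk : k ≠ j) :
    HasDerivAt (fun s => XX j k (ζ s)) 0 t := by
  have hcn : ¬ (vv j (ζ t) ^ 2 = 1 ∧ D2 j (ζ t) = 0 ∧ yy j (ζ t) = 0) := fun h' => hc ⟨h, h'⟩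
  set D := D2 j (ζ t) with hD
  set y := yy j (ζ t) with hy
  set c : ℝ := if k = kz j then 0 else 2 * dd j k (ζ t) with hcdef
  have hDn : 0 ≤ D := D2_nonneg j _
  have hKp : 0 < Kh (MM n) D y (vv j (ζ t)) (hh (ζ t)) := Kh_pos MM_pos hDn (ho.KK_zero h) hcn
  have hv := ho.vv_der h
  have hPhi : HasDerivAt (fun s => Phi j k (ζ s)) (κ * Kd j k (ζ t)) t := by
    have e : (fun s => Phi j k (ζ s)) =ᶠ[𝓝 t] fun s => (om k * Ay (MM n) D y (vv j (ζ s)) +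
        c * AD (MM n) D y (vv j (ζ s))) / (2 * om j) := by
      filter_upwards [ho.dd_const h] with s ⟨h1, h2, h3, h4⟩
      rw [Phi, h2, h3, h4]
    refine HasDerivAt.congr_of_eventuallyEq ?_ e
    have d1 := (Ay_hasDerivAt (MM_pos (n := n)) hDn hcn).comp t hv
    have d2 := (AD_hasDerivAt (MM_pos (n := n)) hDn hcn).comp t hv
    refine (((d1.const_mul (om k)).add (d2.const_mul c)).div_const (2 * om j)).congr_deriv ?_
    rw [gy, gD, ← ho.hh_eta h, Kd, Kr]
    have := om_pos j
    field_simp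
    ring
  have h2 : HasDerivAt (fun s => ((-(Phi j k (ζ s)) : ℝ) : ℂ)) ((-(κ * Kd j k (ζ t)) : ℝ) : ℂ) t :=
    hPhi.neg.ofReal_comp
  refine ((((ho.ww_der h hk).sub_const (pp n : ℂ)).mul
    ((h2.mul_const Complex.I).cexp)).const_add (pp n : ℂ)).congr_deriv ?_
  push_cast; ring

lemma Orb.uu_der (ho : Orb κ ζ) (hc : ∀ j t, ¬ core j (ζ t)) (k : Fin n) (t : ℝ) :
    HasDerivAt (fun s => uu k (ζ s))
      (Complex.I * ((om k * (κ * lam (ζ t)) : ℝ) : ℂ) * uu k (ζ t)) t := by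
  by_cases h : ∃ j, ζ t ∈ OO j
  · obtain ⟨j, hj⟩ := h
    have hX : ∀ᶠ s in 𝓝 t, ∀ l, l ≠ j → XX j l (ζ s) = XX j l (ζ t) :=
      Filter.eventually_all.2 fun l => by
        by_cases hl : l = j
        · simp [hl]
        · filter_upwards [ho.loc_const hj fun s hs => ho.XX_der hs (hc j s) hl] with s hs _ using hs
    have e : (fun s => uu k (ζ s)) =ᶠ[𝓝 t] fun s =>
        Complex.exp (((om k / om j * th j (ζ s) : ℝ) : ℂ) * Complex.I) * Amp j k (ζ t) := by
      filter_upwards [hX, ho.eventually hj] with s h1 h2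
      rw [uu_of_mem h2, UO]
      congr 1
      rw [Amp, Amp]
      split_ifs with hk
      · rw [RR, RR, Finset.sum_congr rfl fun l hl => by rw [h1 l (Finset.ne_of_mem_erase hl)]]
      · exact h1 k hk
    refine HasDerivAt.congr_of_eventuallyEq ?_ e
    have h2 : HasDerivAt (fun s => ((om k / om j * th j (ζ s) : ℝ) : ℂ))
        ((om k / om j * (κ * (om j * Kr j (ζ t))) : ℝ) : ℂ) t :=
      ((ho.th_der hj).const_mul (om k / om j)).ofReal_comp
    refine ((h2.mul_const Complex.I).cexp.mul_const (Amp j k (ζ t))).congr_deriv ?_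
    rw [uu_of_mem hj, UO, lam_of_mem hj]
    rw [show om k / om j * (κ * (om j * Kr j (ζ t))) = om k * (κ * Kr j (ζ t)) by
      have := om_pos j; field_simp]
    ring
  · have h' : ∀ j, ζ t ∉ CC j := fun j hj => h ⟨j, CC_subset_OO j hj⟩
    have e : (fun s => uu k (ζ s)) =ᶠ[𝓝 t] fun s => ζ s k := by
      filter_upwards [ho.eventually_out h'] with s hs using (ho.out hs).2 k
    refine HasDerivAt.congr_of_eventuallyEq ?_ e
    refine (ho.comp k t).congr_deriv ?_
    rw [(ho.out h').2, (ho.out h').1, grad_F0_out h']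
    push_cast; ring

theorem Orb.false (ho : Orb κ ζ) {T : ℝ} (hT : 0 < T) (hper : ∀ t, ζ (t + T) = ζ t) : False := by
  have hc := fun j t => ho.no_core hT hper j t
  set l : ℝ → ℝ := fun t => κ * lam (ζ t) with hl
  have hlc : Continuous l := continuous_const.mul ho.lam_continuous
  set L : ℝ → ℝ := fun s => ∫ x in (0:ℝ)..s, l x with hLdef
  have hL : ∀ t, HasDerivAt L (l t) t := fun t => hlc.integral_hasStrictDerivAt 0 t |>.hasDerivAt
  have hL0 : L 0 = 0 := by simp [hLdef]
  have hLT : 0 < L T := intervalIntegral.intervalIntegral_pos_of_pos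
    (hlc.intervalIntegrable _ _) (fun t => mul_pos ho.pos (ho.lam_pos hc t)) hT
  have hsol : ∀ k s, uu k (ζ s) = uu k (ζ 0) * Complex.exp (((om k * L s : ℝ) : ℂ) * Complex.I) := by
    intro k s
    have := ode_exp (f := fun s => uu k (ζ s)) (c := om k) hL (fun t => ho.uu_der hc k t) s
    rwa [hL0, sub_zero] at this
  have hz : ζ T = ζ 0 := by simpa using hper 0
  have hnz : ∀ k s, uu k (ζ s) ≠ 0 → uu k (ζ 0) ≠ 0 := fun k s h h0 => h (by rw [hsol, h0, zero_mul])
  have hone : ∀ k, uu k (ζ 0) ≠ 0 → Complex.exp (((om k * L T : ℝ) : ℂ) * Complex.I) = 1 := by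
    intro k hk
    have := hsol k T
    rw [hz] at this
    exact (mul_eq_left₀ hk).1 this.symm
  have huniq : ∀ k m, uu k (ζ 0) ≠ 0 → uu m (ζ 0) ≠ 0 → k = m := fun k m hk hm =>
    irr hLT.ne' (hone k hk) (hone m hm)
  obtain ⟨j, hj⟩ : ∃ j, uu j (ζ 0) ≠ 0 := by
    by_cases h : ∃ j, ζ 0 ∈ OO j
    · obtain ⟨j, hj⟩ := h
      exact ⟨j, uu_ne hj⟩
    · push Not at h
      by_contra hcon
      push Not at hcon
      have hQ : Q (ζ 0) = 1 := by rw [← F0_of_notMem h, ho.lev]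
      have : Q (ζ 0) = 0 := by
        rw [Q]
        refine Finset.sum_eq_zero fun k _ => ?_
        rw [← uu_of_notMem h, hcon]; simp
      linarith
  have hother : ∀ k s, k ≠ j → uu k (ζ s) = 0 := fun k s hk => by
    by_contra h
    exact hk (huniq k j (hnz k s h) hj)
  -- a time at which the remaining angle is `1/2`
  obtain ⟨s, hs⟩ : ∃ s, ∃ N : ℤ, om j * L s = 1 / 2 - (uu j (ζ 0)).arg + N * (2 * Real.pi) := by
    obtain ⟨N, hN⟩ := exp_one_int (hone j hj)
    have hpi := Real.pi_pos
    have hpi3 := Real.pi_gt_three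
    have hoL : 0 < om j * L T := mul_pos (om_pos j) hLT
    have hN1 : (1:ℝ) ≤ N := by
      have : 0 < N := by
        by_contra hcon
        push Not at hcon
        have : (N : ℝ) ≤ 0 := by exact_mod_cast hcon
        nlinarith
      exact_mod_cast this
    have hge : 2 * Real.pi ≤ om j * L T := by rw [hN]; nlinarith
    have hLc : ContinuousOn (fun s => om j * L s) (Icc 0 T) :=
      (continuous_const.mul (continuous_iff_continuousAt.2 fun t => (hL t).continuousAt)).continuousOn
    have hivt := intermediate_value_Icc hT.le hLc
    simp only [hL0, mul_zero] at hivt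
    have ha1 := Complex.neg_pi_lt_arg (uu j (ζ 0))
    have ha2 := Complex.arg_le_pi (uu j (ζ 0))
    by_cases hneg : 0 ≤ 1 / 2 - (uu j (ζ 0)).arg
    · obtain ⟨s, _, hs⟩ := hivt ⟨hneg, by linarith⟩
      exact ⟨s, 0, by simpa using hs⟩
    · push Not at hneg
      obtain ⟨s, _, hs⟩ := hivt (show 1 / 2 - (uu j (ζ 0)).arg + 2 * Real.pi ∈ _ from
        ⟨by linarith, by linarith⟩)
      exact ⟨s, 1, by simpa using hs⟩
  obtain ⟨N, hN⟩ := hs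
  have huj : uu j (ζ s) = (‖uu j (ζ 0)‖ : ℂ) * Complex.exp (((1 / 2 : ℝ) : ℂ) * Complex.I) := by
    rw [hsol j s, hN]
    have e0 := Complex.norm_mul_exp_arg_mul_I (uu j (ζ 0))
    generalize (uu j (ζ 0)).arg = a at e0 ⊢
    generalize ‖uu j (ζ 0)‖ = b at e0 ⊢
    rw [← e0, mul_assoc, ← Complex.exp_add]
    congr 1
    rw [Complex.exp_eq_exp_iff_exists_int]
    exact ⟨N, by push_cast; ring⟩
  have hnpos : 0 < ‖uu j (ζ 0)‖ := norm_pos_iff.2 hj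
  have hpi3 := Real.pi_gt_three
  have harg : (uu j (ζ s)).arg = 1 / 2 := by
    rw [huj, Complex.arg_real_mul _ hnpos, Complex.arg_exp_mul_I, toIocMod_eq_self]
    constructor <;> linarith
  by_cases h : ∃ i, ζ s ∈ OO i
  · obtain ⟨i, hi⟩ := h
    have hij : i = j := by
      by_contra hne
      exact uu_ne hi (hother i s hne)
    subst hij
    have hth : th i (ζ s) = 1 / 2 := by
      rw [uu_of_mem hi, UO, Amp, if_pos rfl, div_self (om_pos i).ne', one_mul, mul_comm,
        Complex.arg_real_mul _ (RR_pos hi.2.2), Complex.arg_exp_mul_I, th, (toIocMod_eq_self _).2] at harg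
      · exact harg
      · have := Complex.neg_pi_lt_arg (ζ s i)
        have := Complex.arg_le_pi (ζ s i)
        constructor <;> linarith
    have hX : ∀ k, k ≠ i → dd i k (ζ s) = 0 := fun k hk => by
      have h1 := hother k s hk
      rw [uu_of_mem hi, UO, Amp, if_neg hk] at h1
      have h2 := (mul_eq_zero.1 h1).resolve_left (Complex.exp_ne_zero _)
      have h3 := norm_XX_sub i k (ζ s)
      rw [h2, zero_sub, norm_neg, Complex.norm_real, Real.norm_of_nonneg pp_pos.le] at h3
      rw [dd, if_neg hk, ← h3, sub_self, zero_div]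
    have hX' : ∀ k, dd i k (ζ s) = 0 := fun k => by
      by_cases hk : k = i
      · rw [dd, if_pos hk]
      · exact hX k hk
    refine hc i s ⟨hi, ?_, ?_, ?_⟩
    · rw [vv, hth]; norm_num
    · simp [D2, hX']
    · simp [yy, hX']
  · push Not at h
    have hu := uu_of_notMem h
    have hX' : ∀ k, dd j k (ζ s) = 0 := fun k => by
      by_cases hk : k = j
      · rw [dd, if_pos hk]
      · rw [dd, if_neg hk, ← hu, hother k s hk, zero_sub, norm_neg, norm_EE, sub_self, zero_div]
    have hv : vv j (ζ s) = 1 := by rw [vv, th, ← hu, harg]; norm_num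
    have hQ : Q (ζ s) = 1 := by rw [← F0_of_notMem h, ho.lev]
    refine h j ⟨?_, by rw [hv]; norm_num, ?_⟩
    · rw [← hu, huj, Complex.re_ofReal_mul, Complex.exp_ofReal_mul_I_re]
      exact mul_pos hnpos (Real.cos_pos_of_mem_Ioo ⟨by linarith, by linarith⟩)
    · simp [rr, D2, yy, hh, hX', hQ]

end orb

end Plug

namespace Plug
set_option linter.unusedSectionVars false

/-! ### Rescaled sums and the radial profile -/

def ac (k : ℕ) : ℝ := 1 / (k.factorial : ℝ)
lemma ac_pos (k : ℕ) : 0 < ac k := by unfold ac; positivity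

lemma scaled_sum_contDiff {E : Type*} [NormedAddCommGroup E] [NormedSpace ℝ E] {P : E → ℝ}
    (hP : ContDiff ℝ (⊤ : ℕ∞) P) (hs : HasCompactSupport P) {c : ℕ → ℝ}
    (hc : ∀ k, |c k| ≤ ac k) (a : ℝ) :
    ContDiff ℝ (⊤ : ℕ∞) (fun z => ∑' k, c k * P (a ^ k • z)) := by
  have hb : ∀ m : ℕ, ∃ C, ∀ x, ‖iteratedFDeriv ℝ m P x‖ ≤ C := fun m =>
    (hP.continuous_iteratedFDeriv (by exact_mod_cast le_top)).bounded_above_of_compact_support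
      (hs.iteratedFDeriv m)
  choose C hC using hb
  have hPk : ∀ k : ℕ, ContDiff ℝ (⊤ : ℕ∞) fun z => P (a ^ k • z) := fun k =>
    hP.comp (contDiff_const.smul contDiff_id)
  refine contDiff_tsum (v := fun m k => ac k * ((|a| ^ m) ^ k * C m))
    (fun k => contDiff_const.mul (hPk k)) ?_ ?_
  · intro m _
    have := (Real.summable_pow_div_factorial (|a| ^ m)).mul_right (C m)
    refine this.congr fun k => ?_
    unfold ac; ring
  · intro m k x _
    have e1 : iteratedFDeriv ℝ m (fun z => c k * P (a ^ k • z)) x =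
        c k • iteratedFDeriv ℝ m (fun z => P (a ^ k • z)) x :=
      iteratedFDeriv_const_smul_apply' (i := m) (a := c k)
        (((hPk k).of_le (by exact_mod_cast le_top)).contDiffAt)
    have e2 := congrFun (iteratedFDeriv_comp_const_smul (𝕜 := ℝ) (i := m) (a ^ k) (hP.of_le (by exact_mod_cast le_top))) x
    rw [e1, norm_smul, e2, norm_smul, Real.norm_eq_abs, Real.norm_eq_abs]
    have h1 : |(a ^ k) ^ m| = (|a| ^ m) ^ k := by
      rw [abs_pow, abs_pow, ← pow_mul, ← pow_mul, mul_comm]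
    rw [h1]
    have := (norm_nonneg _).trans (hC m x)
    exact mul_le_mul (hc k) (mul_le_mul_of_nonneg_left (hC m _) (by positivity)) (by positivity) (ac_pos k).le

def bb : ContDiffBump (1:ℝ) := ⟨1 / 5, 7 / 10, by norm_num, by norm_num⟩

lemma bb_zero {x : ℝ} (h : x ≤ 3 / 10 ∨ 17 / 10 ≤ x) : bb x = 0 := by
  apply bb.zero_of_le_dist
  rw [Real.dist_eq]
  change 7 / 10 ≤ _
  rcases h with h | h
  · rw [abs_of_nonpos (by linarith)]; linarith
  · rw [abs_of_nonneg (by linarith)]; linarith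
lemma bb_one {x : ℝ} (h : 4 / 5 ≤ x) (h' : x ≤ 6 / 5) : bb x = 1 := by
  apply bb.one_of_mem_closedBall
  rw [mem_closedBall, Real.dist_eq]
  change _ ≤ 1 / 5
  rw [abs_le]; constructor <;> linarith
lemma bb_pos {x : ℝ} (h : 3 / 10 < x) (h' : x < 17 / 10) : 0 < bb x := by
  apply bb.pos_of_mem_ball
  rw [mem_ball, Real.dist_eq]
  change _ < 7 / 10
  rw [abs_lt]; constructor <;> linarith

def phi (x : ℝ) : ℝ := (∑' k, ac k * bb ((4:ℝ) ^ k • x)) + Real.smoothTransition (x - 5 / 4)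

lemma phi_contDiff : ContDiff ℝ (⊤ : ℕ∞) phi := by
  refine (scaled_sum_contDiff bb.contDiff bb.hasCompactSupport (fun k => ?_) 4).add
    (Real.smoothTransition.contDiff.comp (contDiff_id.sub contDiff_const))
  rw [abs_of_pos (ac_pos k)]

/-- separation of scales -/
lemma scale_sep {k m : ℕ} {x : ℝ} (h : 3 / 10 < 4 ^ k * x) (h' : 4 ^ k * x < 17 / 10) (hm : m ≠ k) :
    4 ^ m * x < 17 / 40 ∨ 6 / 5 < 4 ^ m * x := by
  have hx : 0 < x := by
    by_contra hcon
    push Not at hcon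
    have : (0:ℝ) < 4 ^ k := by positivity
    nlinarith
  rcases lt_or_gt_of_ne hm with hlt | hgt
  · left
    have : (4:ℝ) ^ (m + 1) ≤ 4 ^ k := pow_le_pow_right₀ (by norm_num) hlt
    rw [pow_succ] at this
    nlinarith
  · right
    have : (4:ℝ) ^ (k + 1) ≤ 4 ^ m := pow_le_pow_right₀ (by norm_num) hgt
    rw [pow_succ] at this
    nlinarith

lemma scale_exists {x : ℝ} (hx : 0 < x) (h : x ≤ 6 / 5) :
    ∃ k : ℕ, 3 / 10 < 4 ^ k * x ∧ 4 ^ k * x < 17 / 10 := by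
  obtain ⟨k, h1, h2⟩ := exists_nat_pow_near (x := 6 / 5 / x) (y := (4:ℝ))
    (by rw [le_div_iff₀ hx]; linarith) (by norm_num)
  rw [le_div_iff₀ hx] at h1
  rw [div_lt_iff₀ hx, pow_succ] at h2
  exact ⟨k, by linarith, by linarith⟩

lemma phi_sum_nonneg (x : ℝ) : 0 ≤ ∑' k, ac k * bb ((4:ℝ) ^ k • x) :=
  tsum_nonneg fun k => mul_nonneg (ac_pos k).le bb.nonneg

lemma phi_sum_summable (x : ℝ) : Summable fun k => ac k * bb ((4:ℝ) ^ k • x) := by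
  refine Summable.of_nonneg_of_le (fun k => mul_nonneg (ac_pos k).le bb.nonneg)
    (fun k => ?_) (Real.summable_pow_div_factorial 1)
  have := mul_le_mul_of_nonneg_left (bb.le_one (x := (4:ℝ) ^ k • x)) (ac_pos k).le
  simpa [ac] using this

lemma phi_nonneg (x : ℝ) : 0 ≤ phi x := add_nonneg (phi_sum_nonneg x) (Real.smoothTransition.nonneg _)

lemma phi_pos {x : ℝ} (hx : 0 < x) : 0 < phi x := by
  by_cases h : x ≤ 6 / 5
  · obtain ⟨k, h1, h2⟩ := scale_exists hx h
    refine add_pos_of_pos_of_nonneg ?_ (Real.smoothTransition.nonneg _)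
    exact (phi_sum_summable x).tsum_pos (fun k => mul_nonneg (ac_pos k).le bb.nonneg) k
      (mul_pos (ac_pos k) (bb_pos h1 h2))
  · push Not at h
    by_cases h2 : x < 17 / 10
    · refine add_pos_of_pos_of_nonneg ?_ (Real.smoothTransition.nonneg _)
      exact (phi_sum_summable x).tsum_pos (fun k => mul_nonneg (ac_pos k).le bb.nonneg) 0
        (mul_pos (ac_pos 0) (bb_pos (by simp; linarith) (by simpa using h2)))
    · refine add_pos_of_nonneg_of_pos (phi_sum_nonneg x) (Real.smoothTransition.pos_of_pos (by linarith))

lemma phi_eq {k : ℕ} {x : ℝ} (h : 4 / 5 ≤ 4 ^ k * x) (h' : 4 ^ k * x ≤ 6 / 5) : phi x = ac k := by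
  have hx : 0 < x := by
    by_contra hcon
    push Not at hcon
    have : (0:ℝ) < 4 ^ k := by positivity
    nlinarith
  have h1 : x ≤ 6 / 5 := by
    have : (1:ℝ) ≤ 4 ^ k := one_le_pow₀ (by norm_num)
    nlinarith
  rw [phi, Real.smoothTransition.zero_of_nonpos (by linarith), tsum_eq_single k, add_zero]
  · rw [smul_eq_mul, bb_one h h', mul_one]
  · intro m hm
    rw [smul_eq_mul, bb_zero, mul_zero]
    rcases lt_or_gt_of_ne hm with hlt | hgt
    · left
      have : (4:ℝ) ^ (m + 1) ≤ 4 ^ k := pow_le_pow_right₀ (by norm_num) hlt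
      rw [pow_succ] at this
      nlinarith
    · right
      have : (4:ℝ) ^ (k + 1) ≤ 4 ^ m := pow_le_pow_right₀ (by norm_num) hgt
      rw [pow_succ] at this
      nlinarith

lemma phi_large {x : ℝ} (h : 9 / 4 ≤ x) : 1 ≤ phi x := by
  rw [phi, Real.smoothTransition.one_of_one_le (by linarith)]
  linarith [phi_sum_nonneg x]

def ff (x : ℝ) : ℝ := ∫ t in (0:ℝ)..x, phi t

lemma ff_hasDerivAt (x : ℝ) : HasDerivAt ff (phi x) x :=
  (phi_contDiff.continuous.integral_hasStrictDerivAt 0 x).hasDerivAt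

lemma ff_zero : ff 0 = 0 := by simp [ff]

lemma ff_contDiff : ContDiff ℝ (⊤ : ℕ∞) ff := by
  rw [contDiff_infty_iff_deriv]
  refine ⟨fun x => (ff_hasDerivAt x).differentiableAt, ?_⟩
  rw [show deriv ff = phi from funext fun x => (ff_hasDerivAt x).deriv]
  exact phi_contDiff

lemma ff_continuous : Continuous ff := ff_contDiff.continuous

lemma ff_strictMono : StrictMonoOn ff (Ici 0) := by
  refine strictMonoOn_of_deriv_pos (convex_Ici 0) ff_continuous.continuousOn fun x hx => ?_
  rw [interior_Ici] at hx
  rw [(ff_hasDerivAt x).deriv]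
  exact phi_pos hx

lemma ff_inj {x y : ℝ} (hx : 0 ≤ x) (hy : 0 ≤ y) (h : ff x = ff y) : x = y :=
  ff_strictMono.injOn hx hy h

lemma ff_pos {x : ℝ} (hx : 0 < x) : 0 < ff x := by
  have := ff_strictMono (mem_Ici.2 le_rfl) (mem_Ici.2 hx.le) hx
  rwa [ff_zero] at this
lemma ff_nonneg {x : ℝ} (hx : 0 ≤ x) : 0 ≤ ff x := by
  have := ff_strictMono.monotoneOn (mem_Ici.2 le_rfl) (mem_Ici.2 hx) hx
  rwa [ff_zero] at this

lemma ff_ge {x : ℝ} (hx : 0 ≤ x) : x - 9 / 4 ≤ ff x := by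
  by_cases h : x ≤ 9 / 4
  · linarith [ff_nonneg hx]
  · push Not at h
    have hm : MonotoneOn (fun x => ff x - x) (Ici (9 / 4)) := by
      refine monotoneOn_of_deriv_nonneg (convex_Ici _) (ff_continuous.sub continuous_id).continuousOn
        (fun x _ => ((ff_hasDerivAt x).sub (hasDerivAt_id x)).differentiableAt.differentiableWithinAt) fun x hx => ?_
      rw [interior_Ici] at hx
      have e := ((ff_hasDerivAt x).sub (hasDerivAt_id x)).deriv
      have := phi_large (le_of_lt hx)
      change 0 ≤ deriv (ff - id) x
      rw [e]; linarith
    have := hm (mem_Ici.2 le_rfl) (mem_Ici.2 h.le) h.le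
    have h2 := ff_nonneg (x := 9 / 4) (by norm_num)
    simp only at this
    linarith

lemma ff_affine {k : ℕ} {x y : ℝ} (hx : 4 / 5 ≤ 4 ^ k * x) (hx' : 4 ^ k * x ≤ 6 / 5)
    (hy : 4 / 5 ≤ 4 ^ k * y) (hy' : 4 ^ k * y ≤ 6 / 5) : ff y = ff x + ac k * (y - x) := by
  have h4 : (0:ℝ) < 4 ^ k := by positivity
  have key : ∫ t in x..y, phi t = ac k * (y - x) := by
    rw [intervalIntegral.integral_congr (g := fun _ => ac k)]
    · simp [mul_comm]
    · intro t ht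
      have hs : uIcc x y ⊆ Icc (4 / 5 / 4 ^ k) (6 / 5 / 4 ^ k) := by
        apply uIcc_subset_Icc <;> constructor
        · rw [div_le_iff₀ h4]; linarith
        · rw [le_div_iff₀ h4]; linarith
        · rw [div_le_iff₀ h4]; linarith
        · rw [le_div_iff₀ h4]; linarith
      obtain ⟨h1, h2⟩ := hs ht
      rw [div_le_iff₀ h4] at h1
      rw [le_div_iff₀ h4] at h2
      exact phi_eq (by linarith) (by linarith)
  have h2 := intervalIntegral.integral_add_adjacent_intervals
    (phi_contDiff.continuous.intervalIntegrable 0 x) (phi_contDiff.continuous.intervalIntegrable x y)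
    (μ := MeasureTheory.volume)
  rw [key] at h2
  unfold ff
  linarith

end Plug

namespace Plug
set_option linter.unusedSectionVars false

/-! ### The Hamiltonian -/

lemma Q_nonneg (z : Esp n) : 0 ≤ Q z :=
  Finset.sum_nonneg fun l _ => by have := om_pos l; positivity

lemma Q_smul (a : ℝ) (z : Esp n) : Q (a • z) = a ^ 2 * Q z := by
  unfold Q
  rw [Finset.mul_sum]
  refine Finset.sum_congr rfl fun l _ => ?_
  rw [PiLp.smul_apply, norm_smul, mul_pow, Real.norm_eq_abs, sq_abs]; ring

lemma norm_sq_le_Q (z : Esp n) : ‖z‖ ^ 2 ≤ 2 * Q z := by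
  rw [EuclideanSpace.norm_sq_eq, Q, Finset.mul_sum]
  refine Finset.sum_le_sum fun l _ => ?_
  have := om_ge l
  nlinarith [sq_nonneg ‖z l‖]

lemma Q_pos {z : Esp n} (h : z ≠ 0) : 0 < Q z := by
  have := norm_sq_le_Q z
  have : 0 < ‖z‖ ^ 2 := by have := norm_pos_iff.2 h; positivity
  linarith

lemma Q_zero : Q (0 : Esp n) = 0 := by simp [Q]

lemma two_sq (k : ℕ) : ((2:ℝ) ^ k) ^ 2 = 4 ^ k := by
  rw [← pow_mul, mul_comm, pow_mul]; norm_num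

variable [hn3 : Fact (3 ≤ n)]

lemma F0_nonneg (z : Esp n) : 0 ≤ F0 z := Q_nonneg _

def PP (z : Esp n) : ℝ := F0 z - Q z

lemma PP_contDiff : ContDiff ℝ (⊤ : ℕ∞) (PP (n := n)) := F0_contDiff.sub Q_contDiff

lemma PP_ne {z : Esp n} (h : PP z ≠ 0) : |Q z - 1| < 1 / 100 ∧ |F0 z - 1| < 1 / 100 :=
  F0_ne fun e => h (by rw [PP, e, sub_self])

lemma PP_zero {z : Esp n} (h : Q z ≤ 1 / 2 ∨ 11 / 10 ≤ Q z) : PP z = 0 := by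
  by_contra hne
  have := abs_lt.1 (PP_ne hne).1
  rcases h with h | h <;> linarith

lemma PP_compact : HasCompactSupport (PP (n := n)) := by
  refine HasCompactSupport.intro (isCompact_closedBall (0 : Esp n) 2) fun z hz => ?_
  apply PP_zero
  right
  rw [mem_closedBall_zero_iff, not_le] at hz
  have := norm_sq_le_Q z
  nlinarith

def HH (z : Esp n) : ℝ := ff (Q z) + ∑' k, ac k / 4 ^ k * PP ((2:ℝ) ^ k • z)

lemma HH_contDiff : ContDiff ℝ (⊤ : ℕ∞) (HH (n := n)) := by
  refine (ff_contDiff.comp Q_contDiff).add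
    (scaled_sum_contDiff PP_contDiff PP_compact (fun k => ?_) 2)
  have := ac_pos k
  rw [abs_of_pos (by positivity)]
  exact div_le_self this.le (one_le_pow₀ (by norm_num))

lemma Q_two (k : ℕ) (z : Esp n) : Q ((2:ℝ) ^ k • z) = 4 ^ k * Q z := by rw [Q_smul, two_sq]

lemma HH_out {z : Esp n} (h : 11 / 10 ≤ Q z) : HH z = ff (Q z) := by
  rw [HH, add_eq_left]
  have : ∀ k : ℕ, ac k / 4 ^ k * PP ((2:ℝ) ^ k • z) = 0 := fun k => by
    rw [PP_zero, mul_zero]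
    right
    rw [Q_two]
    have : (1:ℝ) ≤ 4 ^ k := one_le_pow₀ (by norm_num)
    nlinarith
  simp [this]

lemma HH_shell {k : ℕ} {z : Esp n} (h : 3 / 10 < 4 ^ k * Q z) (h' : 4 ^ k * Q z < 17 / 10) :
    HH z = ff (F0 ((2:ℝ) ^ k • z) / 4 ^ k) := by
  have h4 : (0:ℝ) < 4 ^ k := by positivity
  rw [HH, tsum_eq_single k]
  · by_cases h0 : PP ((2:ℝ) ^ k • z) = 0
    · have e : F0 ((2:ℝ) ^ k • z) = 4 ^ k * Q z := by
        rw [PP, Q_two] at h0; linarith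
      rw [h0, e, mul_zero, add_zero, mul_div_cancel_left₀ _ h4.ne']
    · obtain ⟨h1, h2⟩ := PP_ne h0
      rw [abs_lt] at h1 h2
      rw [Q_two] at h1
      rw [ff_affine (k := k) (x := Q z) (y := F0 ((2:ℝ) ^ k • z) / 4 ^ k) (by linarith) (by linarith)
        (by rw [mul_div_cancel₀ _ h4.ne']; linarith) (by rw [mul_div_cancel₀ _ h4.ne']; linarith),
        PP, Q_two]
      field_simp
  · intro m hm
    rw [PP_zero, mul_zero]
    rw [Q_two]
    rcases scale_sep h h' hm with h | h
    · left; linarith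
    · right; linarith

/-- the value of `F0` stays in the shell -/
lemma F0_shell {w : Esp n} (h : 3 / 10 < Q w) (h' : Q w < 17 / 10) :
    3 / 10 < F0 w ∧ F0 w < 17 / 10 := by
  by_cases e : F0 w = Q w
  · rw [e]; exact ⟨h, h'⟩
  · have := abs_lt.1 (F0_ne e).2
    constructor <;> linarith

lemma cover {z : Esp n} (hz : z ≠ 0) :
    11 / 10 < Q z ∨ ∃ k : ℕ, 3 / 10 < 4 ^ k * Q z ∧ 4 ^ k * Q z < 17 / 10 := by
  by_cases h : 11 / 10 < Q z
  · exact Or.inl h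
  · push Not at h
    exact Or.inr (scale_exists (Q_pos hz) (by linarith))

lemma HH_zero : HH (0 : Esp n) = 0 := by
  have : PP (0 : Esp n) = 0 := PP_zero (Or.inl (by rw [Q_zero]; norm_num))
  simp [HH, Q_zero, ff_zero, this]

lemma HH_nonneg (z : Esp n) : 0 ≤ HH z := by
  by_cases hz : z = 0
  · rw [hz, HH_zero]
  · rcases cover hz with h | ⟨k, h1, h2⟩
    · rw [HH_out h.le]; exact ff_nonneg (Q_nonneg z)
    · rw [HH_shell h1 h2]; exact ff_nonneg (div_nonneg (F0_nonneg _) (by positivity))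

lemma HH_ge (z : Esp n) : Q z - 9 / 4 ≤ HH z := by
  by_cases h : 11 / 10 ≤ Q z
  · rw [HH_out h]; exact ff_ge (Q_nonneg z)
  · linarith [HH_nonneg z]

lemma HH_level (k : ℕ) (z : Esp n) : HH z = ff (1 / 4 ^ k) ↔ F0 ((2:ℝ) ^ k • z) = 1 := by
  have h4 : (0:ℝ) < 4 ^ k := by positivity
  have h4' : (1:ℝ) ≤ 4 ^ k := one_le_pow₀ (by norm_num)
  constructor
  · intro h
    have hz : z ≠ 0 := by
      rintro rfl
      rw [HH_zero] at h
      have := ff_pos (x := 1 / 4 ^ k) (by positivity)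
      linarith
    rcases cover hz with h1 | ⟨m, h1, h2⟩
    · rw [HH_out h1.le] at h
      have := ff_inj (Q_nonneg z) (by positivity) h
      have h3 : 1 / (4:ℝ) ^ k ≤ 1 := by rw [div_le_one h4]; exact h4'
      linarith
    · rw [HH_shell h1 h2] at h
      have e := ff_inj (div_nonneg (F0_nonneg _) (by positivity)) (by positivity) h
      rw [← Q_two] at h1 h2
      have hF := F0_shell h1 h2
      have h4m : (0:ℝ) < 4 ^ m := by positivity
      have e2 : 4 ^ k * F0 ((2:ℝ) ^ m • z) = 4 ^ m := by field_simp at e; linarith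
      have hmk : m = k := by
        by_contra hne
        rcases lt_or_gt_of_ne hne with hlt | hgt
        · have : (4:ℝ) ^ (m + 1) ≤ 4 ^ k := pow_le_pow_right₀ (by norm_num) hlt
          rw [pow_succ] at this
          nlinarith
        · have : (4:ℝ) ^ (k + 1) ≤ 4 ^ m := pow_le_pow_right₀ (by norm_num) hgt
          rw [pow_succ] at this
          nlinarith
      subst hmk
      exact mul_left_cancel₀ h4.ne' (by rw [e2, mul_one])
  · intro h
    have : 3 / 10 < Q ((2:ℝ) ^ k • z) ∧ Q ((2:ℝ) ^ k • z) < 17 / 10 := by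
      by_cases e : F0 ((2:ℝ) ^ k • z) = Q ((2:ℝ) ^ k • z)
      · rw [← e, h]; norm_num
      · have := abs_lt.1 (F0_ne e).1
        constructor <;> linarith
    rw [Q_two] at this
    rw [HH_shell this.1 this.2, h]

lemma shell_nhds {k : ℕ} {z : Esp n} (h : 3 / 10 < 4 ^ k * Q z) (h' : 4 ^ k * Q z < 17 / 10) :
    HH =ᶠ[𝓝 z] fun z => ff (F0 ((2:ℝ) ^ k • z) / 4 ^ k) := by
  have c : ContinuousAt (fun z : Esp n => 4 ^ k * Q z) z :=
    (continuous_const.mul Q_contDiff.continuous).continuousAt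
  filter_upwards [c.eventually_mem (Ioo_mem_nhds h h')] with w hw using HH_shell hw.1 hw.2

lemma grad_nz {z : Esp n} {F : Esp n → ℝ} (hF : HH =ᶠ[𝓝 z] F) {c : ℝ → Esp n} {qq : ℝ}
    (hq : 0 < qq) (hc : DifferentiableAt ℝ c 0) (h0 : c 0 = z)
    (h : ∀ t, F (c t) = ff ((1 + t) ^ 2 * qq)) : gradient HH z ≠ 0 := by
  intro hg
  have hd : HasFDerivAt HH (fderiv ℝ HH (c 0)) (c 0) :=
    (HH_contDiff.differentiable (by simp) _).hasFDerivAt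
  have h1 := hd.comp_hasDerivAt (0:ℝ) hc.hasDerivAt
  rw [h0, ← grad_inner, hg, inner_zero_left] at h1
  have e : (HH ∘ c) =ᶠ[𝓝 0] fun t => ff ((1 + t) ^ 2 * qq) := by
    rw [← h0] at hF
    filter_upwards [hc.continuousAt.eventually hF] with t ht
    rw [Function.comp, ht, h]
  have h2 : HasDerivAt (fun t : ℝ => (1 + t) ^ 2 * qq) (2 * qq) 0 := by
    have := (((hasDerivAt_id (0:ℝ)).const_add 1).pow 2).mul_const qq
    refine this.congr_deriv ?_
    simp
  have h3 : HasDerivAt (fun t : ℝ => ff ((1 + t) ^ 2 * qq)) (phi qq * (2 * qq)) 0 := by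
    have h5 : HasDerivAt ff (phi qq) ((1 + 0) ^ 2 * qq) := by simpa using ff_hasDerivAt qq
    exact h5.comp (0:ℝ) h2
  have := h1.unique (h3.congr_of_eventuallyEq e)
  have h4 := phi_pos hq
  have : 0 < phi qq * (2 * qq) := by positivity
  linarith

lemma HH_grad_ne {z : Esp n} (hz : z ≠ 0) : gradient HH z ≠ 0 := by
  rcases cover hz with h | ⟨k, h1, h2⟩
  · have hF : HH =ᶠ[𝓝 z] fun z => ff (Q z) := by
      filter_upwards [Q_contDiff.continuous.continuousAt.eventually_mem (Ioi_mem_nhds h)] with w hw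
        using HH_out (le_of_lt hw)
    refine grad_nz hF (c := fun t => (1 + t) • z) (Q_pos hz) (by fun_prop) (by simp) fun t => ?_
    rw [Q_smul]
  · set w := (2:ℝ) ^ k • z with hw
    have h2k : (0:ℝ) < 2 ^ k := by positivity
    have hw1 := F0_shell (w := w) (by rw [Q_two]; exact h1) (by rw [Q_two]; exact h2)
    refine grad_nz (shell_nhds h1 h2) (qq := F0 w / 4 ^ k)
      (c := fun t => ((2:ℝ) ^ k)⁻¹ • DD (-1) ((1 + t) • DD 1 w)) ?_ ?_ ?_ fun t => ?_
    · have : 0 < F0 w := by linarith [hw1.1]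
      positivity
    · have hd : Differentiable ℝ (DD (n := n) (-1)) := (DD_contDiff (-1)).differentiable (by simp)
      fun_prop
    · simp only [add_zero, one_smul]
      rw [DD_DD 1 w, hw, inv_smul_smul₀ h2k.ne']
    · rw [smul_inv_smul₀ h2k.ne', F0]
      have := DD_DD (-1) ((1 + t) • DD 1 w)
      rw [neg_neg] at this
      rw [this, Q_smul, F0, mul_div_assoc]

lemma grad_shell {k : ℕ} {z : Esp n} (h : F0 ((2:ℝ) ^ k • z) = 1) :
    (2:ℝ) ^ k • gradient HH z = phi (1 / 4 ^ k) • gradient F0 ((2:ℝ) ^ k • z) := by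
  have hs : 3 / 10 < Q ((2:ℝ) ^ k • z) ∧ Q ((2:ℝ) ^ k • z) < 17 / 10 := by
    by_cases e : F0 ((2:ℝ) ^ k • z) = Q ((2:ℝ) ^ k • z)
    · rw [← e, h]; norm_num
    · have := abs_lt.1 (F0_ne e).1
      constructor <;> linarith
  rw [Q_two] at hs
  refine ext_inner_right ℝ fun e => ?_
  rw [inner_smul_left, inner_smul_left, grad_inner, grad_inner]
  have hF : HasFDerivAt F0 (fderiv ℝ F0 ((2:ℝ) ^ k • z)) ((2:ℝ) ^ k • z) :=
    (F0_differentiableAt _).hasFDerivAt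
  have hl : HasFDerivAt (fun z : Esp n => (2:ℝ) ^ k • z)
      ((2:ℝ) ^ k • ContinuousLinearMap.id ℝ (Esp n)) z :=
    ((2:ℝ) ^ k • ContinuousLinearMap.id ℝ (Esp n)).hasFDerivAt
  have h1 := (hF.comp z hl).mul_const ((4:ℝ) ^ k)⁻¹
  have h2 : HasDerivAt ff (phi (1 / 4 ^ k)) (F0 ((2:ℝ) ^ k • z) * ((4:ℝ) ^ k)⁻¹) := by
    rw [h, one_mul, one_div]; exact ff_hasDerivAt _
  have h3 := (h2.comp_hasFDerivAt z h1).congr_of_eventuallyEq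
    ((shell_nhds hs.1 hs.2).trans (Filter.Eventually.of_forall fun w => by
      simp [Function.comp, div_eq_mul_inv]))
  rw [h3.fderiv]
  have e4 := two_sq k
  have h2k : (2:ℝ) ^ k ≠ 0 := by positivity
  simp only [smul_apply, ContinuousLinearMap.comp_apply,
    ContinuousLinearMap.id_apply, map_smul, smul_eq_mul, ← e4, RCLike.conj_to_real]
  field_simp

/-- the linear normalisation of the ellipsoid -/
def LL : Esp n ≃ₜ Esp n where
  toFun z := WithLp.toLp 2 fun l => (√(om l / 2) : ℂ) * z l
  invFun z := WithLp.toLp 2 fun l => (√(om l / 2) : ℂ)⁻¹ * z l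
  left_inv z := by
    refine PiLp.ext fun l => ?_
    have : (√(om l / 2) : ℂ) ≠ 0 := by
      have := om_pos l
      exact_mod_cast (Real.sqrt_pos.2 (by positivity)).ne'
    exact inv_mul_cancel_left₀ this _
  right_inv z := by
    refine PiLp.ext fun l => ?_
    have : (√(om l / 2) : ℂ) ≠ 0 := by
      have := om_pos l
      exact_mod_cast (Real.sqrt_pos.2 (by positivity)).ne'
    exact mul_inv_cancel_left₀ this _
  continuous_toFun := by fun_prop
  continuous_invFun := by fun_prop

lemma LL_contDiff : ContDiff ℝ (⊤ : ℕ∞) (LL (n := n)) := by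
  refine contDiff_piLp' 2 fun l => ?_
  exact contDiff_const.mul (coord_contDiff l)
lemma LL_symm_contDiff : ContDiff ℝ (⊤ : ℕ∞) (LL (n := n)).symm := by
  refine contDiff_piLp' 2 fun l => ?_
  exact contDiff_const.mul (coord_contDiff l)

lemma norm_LL (z : Esp n) : ‖LL z‖ ^ 2 = Q z := by
  rw [EuclideanSpace.norm_sq_eq, Q]
  refine Finset.sum_congr rfl fun l _ => ?_
  have := om_pos l
  change ‖(√(om l / 2) : ℂ) * z l‖ ^ 2 = _
  rw [norm_mul, mul_pow, Complex.norm_real, Real.norm_eq_abs, sq_abs, Real.sq_sqrt (by positivity)]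
  ring

theorem main (n : ℕ) [hn3 : Fact (3 ≤ n)] : ∃ H : Esp n → ℝ, ContDiff ℝ (⊤ : ℕ∞) H ∧
      (∀ s : Set ℝ, IsCompact s → IsCompact (H ⁻¹' s)) ∧
      H 0 = 0 ∧ (∀ x, H 0 ≤ H x) ∧
      gradient H 0 = 0 ∧ (∀ x : Esp n, x ≠ 0 → gradient H x ≠ 0) ∧
      ∃ ε : ℕ → ℝ, (∀ k, 0 < ε k) ∧
        Filter.Tendsto ε Filter.atTop (𝓝 0) ∧
        ∀ k, (∀ x, H x = ε k → gradient H x ≠ 0) ∧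
          (∃ φ : Esp n ≃ₜ Esp n, ContDiff ℝ (⊤ : ℕ∞) φ ∧
            ContDiff ℝ (⊤ : ℕ∞) φ.symm ∧
            φ '' (H ⁻¹' {ε k}) = sphere (0 : Esp n) 1) ∧
          ¬ ∃ γ T, IsPeriodicOrbit H γ T ∧ ∀ t, H (γ t) = ε k := by
  have hmin : ∀ x : Esp n, HH (0 : Esp n) ≤ HH x := fun x => by rw [HH_zero]; exact HH_nonneg x
  refine ⟨HH, HH_contDiff, ?_, HH_zero, hmin, ?_, fun x hx => HH_grad_ne hx,
    fun k => ff (1 / 4 ^ k), fun k => ff_pos (by positivity), ?_, fun k => ⟨?_, ?_, ?_⟩⟩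
  · intro s hs
    obtain ⟨B, hB⟩ := hs.bddAbove
    refine (isCompact_closedBall (0 : Esp n) (√(2 * (B + 9 / 4)))).of_isClosed_subset
      (hs.isClosed.preimage HH_contDiff.continuous) fun z hz => ?_
    rw [mem_closedBall_zero_iff]
    apply Real.le_sqrt_of_sq_le
    have h1 := hB hz
    have h2 := HH_ge z
    have h3 := norm_sq_le_Q z
    linarith
  · have h : IsLocalMin (HH (n := n)) 0 := Filter.Eventually.of_forall hmin
    rw [gradient, h.fderiv_eq_zero, map_zero]
  · have h1 : Filter.Tendsto (fun k : ℕ => 1 / (4:ℝ) ^ k) Filter.atTop (𝓝 0) := by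
      have := tendsto_pow_atTop_nhds_zero_of_lt_one (r := (1:ℝ) / 4) (by norm_num) (by norm_num)
      simpa [one_div, inv_pow] using this
    have := (ff_continuous.tendsto 0).comp h1
    rwa [ff_zero] at this
  · intro x hx
    apply HH_grad_ne
    rintro rfl
    rw [HH_zero] at hx
    have := ff_pos (x := 1 / 4 ^ k) (by positivity)
    linarith
  · have h2 : ((2:ℝ) ^ k) ≠ 0 := by positivity
    refine ⟨((Homeomorph.smulOfNeZero _ h2).trans DDe).trans LL, ?_, ?_, ?_⟩
    · have hs : ∀ c : ℝ, ContDiff ℝ (⊤ : ℕ∞) (fun z : Esp n => c • z) := fun c => by fun_prop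
      have e1 : ContDiff ℝ (⊤ : ℕ∞) (fun z : Esp n => LL (DD 1 ((2:ℝ)^k • z))) :=
        LL_contDiff.comp ((DD_contDiff 1).comp (hs _))
      exact e1
    · have hs : ∀ c : ℝ, ContDiff ℝ (⊤ : ℕ∞) (fun z : Esp n => c • z) := fun c => by fun_prop
      have e2 : ContDiff ℝ (⊤ : ℕ∞) (fun z : Esp n => ((2:ℝ)^k)⁻¹ • DD (-1) (LL.symm z)) :=
        (hs _).comp ((DD_contDiff (-1)).comp LL_symm_contDiff)
      exact e2
    · have key : ∀ z : Esp n, HH z = ff (1 / 4 ^ k) ↔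
          ‖(((Homeomorph.smulOfNeZero _ h2).trans DDe).trans LL) z‖ = 1 := fun z => by
        rw [HH_level, F0, ← norm_LL]
        change ‖LL (DD 1 ((2:ℝ) ^ k • z))‖ ^ 2 = 1 ↔ ‖LL (DD 1 ((2:ℝ) ^ k • z))‖ = 1
        exact pow_eq_one_iff_of_nonneg (norm_nonneg _) (by norm_num)
      ext w
      rw [mem_sphere_zero_iff_norm]
      constructor
      · rintro ⟨z, hz, rfl⟩
        exact (key z).1 hz
      · intro hw
        obtain ⟨z, rfl⟩ := (((Homeomorph.smulOfNeZero _ h2).trans DDe).trans LL).surjective w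
        exact ⟨z, (key z).2 hw, rfl⟩
  · rintro ⟨γ, T, ⟨hT, hder, hper, _⟩, hlev⟩
    have hl : ∀ t, F0 ((2:ℝ) ^ k • γ t) = 1 := fun t => (HH_level k _).1 (hlev t)
    have ho : Orb (phi (1 / 4 ^ k)) (fun t => (2:ℝ) ^ k • γ t) := by
      refine ⟨phi_pos (by positivity), fun t => ?_, hl⟩
      refine ((hder t).const_smul ((2:ℝ) ^ k)).congr_deriv ?_
      rw [hamVF, smul_comm, grad_shell (hl t), smul_comm]
    exact ho.false hT fun t => by rw [hper]

end Plug

/-- **Proposition 2.13 of Ginzburg–Gürel (case `2n ≥ 6`)**: for `n ≥ 3` there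
is a proper `C^∞` function `H : ℝ^{2n} → ℝ` whose only critical point is the
origin, where it attains its absolute minimum `H 0 = 0`, together with a
sequence of positive regular values `ε_k → 0` whose level sets are (ambiently)
diffeomorphic to the standard sphere `S^{2n-1}` and carry no nonconstant
periodic orbit of the Hamiltonian flow of `H`. -/
theorem stmt_15 (n : ℕ) (hn : 3 ≤ n) :
    ∃ H : Esp n → ℝ, ContDiff ℝ (⊤ : ℕ∞) H ∧
      (∀ s : Set ℝ, IsCompact s → IsCompact (H ⁻¹' s)) ∧
      H 0 = 0 ∧ (∀ x, H 0 ≤ H x) ∧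
      gradient H 0 = 0 ∧ (∀ x : Esp n, x ≠ 0 → gradient H x ≠ 0) ∧
      ∃ ε : ℕ → ℝ, (∀ k, 0 < ε k) ∧
        Filter.Tendsto ε Filter.atTop (𝓝 0) ∧
        ∀ k, (∀ x, H x = ε k → gradient H x ≠ 0) ∧
          (∃ φ : Esp n ≃ₜ Esp n, ContDiff ℝ (⊤ : ℕ∞) φ ∧
            ContDiff ℝ (⊤ : ℕ∞) φ.symm ∧
            φ '' (H ⁻¹' {ε k}) = sphere (0 : Esp n) 1) ∧
          ¬ ∃ γ T, IsPeriodicOrbit H γ T ∧ ∀ t, H (γ t) = ε k := by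
  have : Fact (3 ≤ n) := ⟨hn⟩
  exact Plug.main n
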